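/- Let k be a positive odd integer and let h : ℝ³ → ℍ be a smooth function with compact support. Set c = (∏_{j=0}^{(k−1)/2} (3 + 2j)) · (∏_{j=1}^{(k−1)/2} |2j − 3|). Then (∫_{ℝ³} ‖D^k h(x)‖² (1 + ‖x‖²)^k dx)^{1/2} ≥ c · (∫_{ℝ³} ‖h(x)‖² / (1 + ‖x‖²)^k dx)^{1/2}, where D^k denotes the k-fold iterate of D. (This is the case n = 3 of the paper's sharp weighted inequality for odd powers of the Dirac operator, with c = |n(n+2)(2−n)⋯(n+k−1)(k−1−n)| for n = 3.) -/

import Mathlib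

noncomputable section

/-- The quaternion `i`. -/
def qI : Quaternion ℝ := ⟨0, 1, 0, 0⟩

/-- The quaternion `j`. -/
def qJ : Quaternion ℝ := ⟨0, 0, 1, 0⟩

/-- The quaternion `k`. -/
def qK : Quaternion ℝ := ⟨0, 0, 0, 1⟩

/-- The Dirac (Moisil–Teodorescu) operator
`Dh(x) = i·(∂h/∂x₁)(x) + j·(∂h/∂x₂)(x) + k·(∂h/∂x₃)(x)` on quaternion-valued
functions on `ℝ³`, using left quaternionic multiplication. -/
def diracQ (h : EuclideanSpace ℝ (Fin 3) → Quaternion ℝ) :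
    EuclideanSpace ℝ (Fin 3) → Quaternion ℝ := fun x =>
  qI * fderiv ℝ h x (EuclideanSpace.single 0 1) +
    qJ * fderiv ℝ h x (EuclideanSpace.single 1 1) +
    qK * fderiv ℝ h x (EuclideanSpace.single 2 1)

section
-- Part I
theorem rel_R {R : Type*} [Ring R] (D X J U : R) (h1 : D * X + X * D = -3 - 2 * U)
   (h2 : D * J = J * D + 2 * X) (h3 : D * U = U * D + D) (h4 : U * J = J * U + 2 * (J - 1))
   (h5 : X * X = 1 - J) (h6 : X * J = J * X) :
   (J*D)*(J*D)*X - 2*X*(J*D)*X - X*(J*D)*(J*D) + 2*(J*D) = 0 := by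
  have hY : J*D*X + X*(J*D) = -(J*(3+2*U)) := by
    linear_combination (norm := noncomm_ring) J * h1 + h6 * D
  linear_combination (norm := noncomm_ring) (J*D)*hY - hY*(J*D) - J*h2*(3+2*U)
     -2*J*J*h3 + 2*J*h4*D + 2*h6*(3+2*U)-2*X*hY + 2*h5*J*D

theorem step_R {R : Type*} [Ring R] (A X f g r : R) (hr : ∀ z, r * z = z * r)
    (hR : A*A*X - 2*X*A*X - X*A*A + 2*A = 0)
    (hf : A * f = f * A) (h : A*f*X - X*f*A = 2*r*(X*f*X - f))
    (hg : g = f*A*A - 4*r*r*f) :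
    A * g * X - X * g * A = 2*(r+1)*(X*g*X - g) := by
  have e1 : A*(r*r*f) = r*r*(A*f) := by
    linear_combination (norm := noncomm_ring) -(hr A)*r*f - r*(hr A)*f
  have e2 : X*(r*r*f) = r*r*(X*f) := by
    linear_combination (norm := noncomm_ring) -(hr X)*r*f - r*(hr X)*f
  subst hg
  linear_combination (norm := noncomm_ring) A*f*hR + h*(A*A+2*A*X) - 4*r*r*h - 4*e1*X
    + 4*e2*A + 8*(r+1)*e2*X - 2*r*X*f*hR - 2*hf*A + 4*r*hf*X - 4*r*h

/-- the polynomial -/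
def fpol {R : Type*} [Ring R] (A : R) : ℕ → R
  | 0 => A
  | r+1 => fpol A r * A * A - 4 * ((r:R)+1)*((r:R)+1) * fpol A r

theorem fpol_comm {R : Type*} [Ring R] (A : R) (r : ℕ) : A * fpol A r = fpol A r * A := by
  induction r with
  | zero => rfl
  | succ r ih =>
    have hr : A * (((r+1:ℕ):R)*((r+1:ℕ):R)) = ((r+1:ℕ):R)*((r+1:ℕ):R) * A := by
      rw [← Nat.cast_mul]; exact (Nat.cast_commute _ _).symm.eq
    push_cast at hr
    simp only [fpol]
    linear_combination (norm := noncomm_ring) ih*A*A - 4*((r:R)+1)*((r:R)+1)*ih - 4*hr*fpol A r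

theorem fpol_rel {R : Type*} [Ring R] (A X : R)
    (hR : A*A*X - 2*X*A*X - X*A*A + 2*A = 0) (r : ℕ) :
    A*fpol A r*X - X*fpol A r*A = 2*((r:R)+1)*(X*fpol A r*X - fpol A r) := by
  induction r with
  | zero => simp only [fpol]; linear_combination (norm := (push_cast; noncomm_ring)) hR
  | succ r ih =>
    push_cast
    exact step_R A X _ _ ((r:R)+1) (fun z => by
      have := (Nat.cast_commute (r+1) z).eq; push_cast at this; exact this) hR (fpol_comm A r) ih rfl

theorem fpol_step {R : Type*} [Ring R] (A X : R)
    (hR : A*A*X - 2*X*A*X - X*A*A + 2*A = 0) (r : ℕ) :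
    (A - 2*((r:R)+1)*X) * fpol A r * (A + 2*((r:R)+1)*X) = fpol A (r+1) := by
  have h := fpol_rel A X hR r
  have hc := fpol_comm A r
  have hr : ∀ z : R, z * ((r:R)+1) = ((r:R)+1) * z := (fun z => by
      have := (Nat.cast_commute (r+1) z).eq; push_cast at this; exact this.symm)
  have e1 := hr (A * fpol A r)
  have e2 := hr (X * fpol A r)
  simp only [fpol]
  set q := (r:R)+1
  linear_combination (norm := noncomm_ring) 2*q*h + 2*e1*X - 4*q*e2*X + hc*A

theorem DJ_pow {R : Type*} [Ring R] (D X J : R) (h2 : D * J = J * D + 2 * X)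
   (h6 : X * J = J * X) (r : ℕ) :
   D * J^(r+1) = J^(r+1)*D + 2*((r:R)+1)*J^r*X := by
  induction r with
  | zero => simpa using h2
  | succ r ih =>
    have hr : ∀ z : R, z * (r:R) = (r:R) * z := fun z => (Nat.cast_commute r z).eq.symm
    have e : J^(r+1) = J^r * J := pow_succ _ _
    rw [pow_succ J (r+1)]
    push_cast
    rw [e] at ih ⊢
    linear_combination (norm := noncomm_ring) ih*J + J^r*J*h2 + 2*((r:R)+1)*J^r*h6

theorem T_eq {R : Type*} [Ring R] (D X J : R) (h2 : D * J = J * D + 2 * X)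
   (h6 : X * J = J * X)
   (hR : (J*D)*(J*D)*X - 2*X*(J*D)*X - X*(J*D)*(J*D) + 2*(J*D) = 0) (r : ℕ) :
   J^(r+1) * D^(2*r+1) * J^r = fpol (J*D) r := by
  induction r with
  | zero => simp [fpol]
  | succ r ih =>
    rw [← fpol_step _ X hR r, ← ih]
    have h := DJ_pow D X J h2 h6 r
    have e : J^(r+1) = J^r * J := pow_succ _ _
    have e' : J^(r+1+1) = J * J^(r+1) := pow_succ' _ _
    have hx : X * J^r = J^r * X := (Commute.pow_right (show Commute X J from h6) r).eq
    have hr : ∀ z : R, z * ((r:R)+1) = ((r:R)+1) * z := (fun z => by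
      have := (Nat.cast_commute (r+1) z).eq; push_cast at this; exact this.symm)
    have hJr : J * J^r = J^r * J := (Commute.pow_right (Commute.refl J) r).eq
    have r1 : D * J^(r+1) = J^r * (J*D + 2*((r:R)+1)*X) := by
      rw [h, e]
      linear_combination (norm := noncomm_ring) -2*hr (J^r) * X
    have r2 : J^(r+1+1)*D = (J*D - 2*((r:R)+1)*X)*J^(r+1) := by
      rw [sub_mul, mul_assoc J D, h, e']
      rw [e]
      linear_combination (norm := noncomm_ring) 2*((r:R)+1)*hx*J + 2*((r:R)+1)*J^r*h6  - 2*hr J * J^r * X - 2*((r:R)+1)*hJr * X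
    have : D^(2*(r+1)+1) = D * D^(2*r+1) * D := by
      rw [← pow_succ', ← pow_succ]; ring_nf
    rw [this]
    calc _ = (J^(r+1+1)*D) * D^(2*r+1) * (D * J^(r+1)) := by noncomm_ring
      _ = _ := by rw [r1, r2]; noncomm_ring
end

section
open scoped Quaternion
noncomputable section
section PartII
variable {S : Type*} [Ring S] [Algebra ℝ S]

/-- filtration -/
def Wn (y : Fin 4 → S) (ψ : ℍ[ℝ] →ₗ[ℝ] S) : ℕ → Submodule ℝ S
  | 0 => LinearMap.range ψ
  | n+1 => Wn y ψ n ⊔ ⨆ i, (Wn y ψ n).map (LinearMap.mulLeft ℝ (y i))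

variable {y γ : Fin 4 → S} {ψ : ℍ[ℝ] →ₗ[ℝ] S} {A : S →ₗ[ℝ] S}

theorem Wn_mono (n : ℕ) {f : S} (hf : f ∈ Wn y ψ n) : f ∈ Wn y ψ (n+1) :=
  Submodule.mem_sup_left hf

theorem Wn_y (n : ℕ) (i) {f : S} (hf : f ∈ Wn y ψ n) : y i * f ∈ Wn y ψ (n+1) :=
  Submodule.mem_sup_right (Submodule.mem_iSup_of_mem i ⟨f, hf, rfl⟩)

theorem Wn_ind {n : ℕ} {L : S →ₗ[ℝ] S} {V : Submodule ℝ S}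
    (h1 : ∀ f ∈ Wn y ψ n, L f ∈ V) (h2 : ∀ i, ∀ f ∈ Wn y ψ n, L (y i * f) ∈ V) :
    ∀ f ∈ Wn y ψ (n+1), L f ∈ V := by
  have : Wn y ψ (n+1) ≤ V.comap L := by
    refine sup_le h1 (iSup_le fun i => ?_)
    rw [Submodule.map_le_iff_le_comap]
    exact fun f hf => h2 i f hf
  exact this

theorem Wn_gamma (hyc : ∀ i f, y i * f = f * y i)
    (hγψ : ∀ i c, γ i * ψ c ∈ Wn y ψ 1) (n : ℕ) (i) : ∀ f ∈ Wn y ψ n, γ i * f ∈ Wn y ψ (n+1) := by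
  induction n with
  | zero => rintro _ ⟨c, rfl⟩; exact hγψ i c
  | succ n ih =>
    refine Wn_ind (L := LinearMap.mulLeft ℝ (γ i)) (fun f hf => Wn_mono _ (ih f hf)) fun j f hf => ?_
    have : LinearMap.mulLeft ℝ (γ i) (y j * f) = y j * (γ i * f) := by
      simp only [LinearMap.mulLeft_apply]; rw [← mul_assoc, ← hyc, mul_assoc]
    rw [this]
    exact Wn_y _ _ (ih f hf)

theorem Wn_A (hyc : ∀ i f, y i * f = f * y i)
    (hγψ : ∀ i c, γ i * ψ c ∈ Wn y ψ 1)
    (hA : ∀ i f, A (y i * f) = y i * A f + γ i * f)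
    (hψ : ∀ c, A (ψ c) = (3:ℝ) • ψ c) (n : ℕ) : ∀ f ∈ Wn y ψ n, A f ∈ Wn y ψ n := by
  induction n with
  | zero => rintro _ ⟨c, rfl⟩; rw [hψ]; exact Submodule.smul_mem _ _ ⟨c, rfl⟩
  | succ n ih =>
    refine Wn_ind (fun f hf => Wn_mono _ (ih f hf)) fun j f hf => ?_
    rw [hA]
    exact add_mem (Wn_y _ _ (ih f hf)) (Wn_gamma hyc hγψ _ _ _ hf)

/-- Casimir -/
def Cas (A : S →ₗ[ℝ] S) : S →ₗ[ℝ] S := A ∘ₗ A - (2:ℝ) • A - (3:ℝ) • LinearMap.id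

theorem Cas_apply (f : S) : Cas A f = A (A f) - (2:ℝ) • A f - (3:ℝ) • f := rfl

/-- commutator of Casimir -/
def Gop (A : S →ₗ[ℝ] S) (y : S) : S →ₗ[ℝ] S :=
  Cas A ∘ₗ LinearMap.mulLeft ℝ y - LinearMap.mulLeft ℝ y ∘ₗ Cas A

theorem Gop_apply (f : S) (z : S) : Gop A z f = Cas A (z * f) - z * Cas A f := rfl

theorem Gop_eq (hA : ∀ i f, A (y i * f) = y i * A f + γ i * f) (i) (f : S) :
    Gop A (y i) f = A (γ i * f) + γ i * A f - (2:ℝ) • (γ i * f) := by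
  rw [Gop_apply, Cas_apply, Cas_apply, hA, map_add, hA]
  simp only [mul_sub, mul_smul_comm, smul_add]
  abel

theorem Gop_y (hyc : ∀ i f, y i * f = f * y i) (hA : ∀ i f, A (y i * f) = y i * A f + γ i * f)
    (hγ : ∀ i j, γ i * γ j + γ j * γ i = (8:ℝ) • (y i * y j) - (if i = j then (8:ℝ) else 0) • 1)
    (i j) (f : S) : Gop A (y i) (y j * f) = y j * Gop A (y i) f + (8:ℝ) • (y i * (y j * f))
      - (if i = j then (8:ℝ) else 0) • f := by
  rw [Gop_eq hA, Gop_eq hA]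
  have e : γ i * (y j * f) = y j * (γ i * f) := by rw [← mul_assoc, ← hyc, mul_assoc]
  rw [e, hA, hA]
  have := congrArg (· * f) (hγ i j)
  simp only [add_mul, sub_mul, smul_mul_assoc, one_mul, mul_assoc] at this
  have e2 : γ i * (y j * A f) = y j * (γ i * A f) := by rw [← mul_assoc, ← hyc, mul_assoc]
  rw [mul_add, e2, mul_sub, mul_add, mul_smul_comm]
  rw [add_sub_assoc (_ + _ - _), ← this]
  abel

theorem Gop_claim (hyc : ∀ i f, y i * f = f * y i) (hA : ∀ i f, A (y i * f) = y i * A f + γ i * f)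
    (hγ : ∀ i j, γ i * γ j + γ j * γ i = (8:ℝ) • (y i * y j) - (if i = j then (8:ℝ) else 0) • 1)
    (h0 : ∀ i c, Gop A (y i) (ψ c) = (12:ℝ) • (y i * ψ c)) (l : ℕ) (i) :
    ∀ f ∈ Wn y ψ l, Gop A (y i) f - (12 + 8 * (l:ℝ)) • (y i * f) ∈ Wn y ψ l := by
  induction l with
  | zero => rintro _ ⟨c, rfl⟩; rw [h0]; simp
  | succ l ih =>
    refine Wn_ind (L := Gop A (y i) - (12 + 8 * ((l+1:ℕ):ℝ)) • LinearMap.mulLeft ℝ (y i))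
      (fun f hf => ?_) fun j f hf => ?_
    · have := sub_mem (Wn_mono _ (ih f hf)) (Submodule.smul_mem _ (8:ℝ) (Wn_y _ i hf))
      convert this using 1
      simp only [LinearMap.sub_apply, LinearMap.smul_apply, LinearMap.mulLeft_apply]
      push_cast; module
    · have := sub_mem (Wn_y _ j (ih f hf))
        (Submodule.smul_mem _ (if i = j then (8:ℝ) else 0) (Wn_mono _ hf))
      convert this using 1
      simp only [LinearMap.sub_apply, LinearMap.smul_apply, LinearMap.mulLeft_apply]
      rw [Gop_y hyc hA hγ]
      have e : y j * (y i * f) = y i * (y j * f) := by rw [← mul_assoc, ← hyc, mul_assoc]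
      rw [mul_sub, mul_smul_comm, e]
      push_cast; module

theorem Cas_claim (hyc : ∀ i f, y i * f = f * y i) (hA : ∀ i f, A (y i * f) = y i * A f + γ i * f)
    (hγψ : ∀ i c, γ i * ψ c ∈ Wn y ψ 1)
    (hψ : ∀ c, A (ψ c) = (3:ℝ) • ψ c)
    (hγ : ∀ i j, γ i * γ j + γ j * γ i = (8:ℝ) • (y i * y j) - (if i = j then (8:ℝ) else 0) • 1)
    (h0 : ∀ i c, Gop A (y i) (ψ c) = (12:ℝ) • (y i * ψ c)) (l : ℕ) :
    ∀ f ∈ Wn y ψ (l+1), Cas A f - (4 * ((l:ℝ)+1)*(l+3)) • f ∈ Wn y ψ l := by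
  have key : ∀ l, (∀ i, ∀ f ∈ Wn y ψ l, y i * (Cas A f - (4*(l:ℝ)*(l+2)) • f) ∈ Wn y ψ l) →
     ∀ f ∈ Wn y ψ (l+1), Cas A f - (4 * ((l:ℝ)+1)*(l+3)) • f ∈ Wn y ψ l := by
    intro l hl
    have hAA := Wn_A hyc hγψ hA hψ l
    refine Wn_ind (L := Cas A - (4 * ((l:ℝ)+1)*(l+3)) • LinearMap.id) (fun f hf => ?_) fun j f hf => ?_
    · refine sub_mem ?_ (Submodule.smul_mem _ _ hf)
      rw [Cas_apply]
      exact sub_mem (sub_mem (hAA _ (hAA _ hf)) (Submodule.smul_mem _ _ (hAA _ hf)))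
        (Submodule.smul_mem _ _ hf)
    · have := add_mem (hl j f hf) (Gop_claim hyc hA hγ h0 l j f hf)
      convert this using 1
      simp only [LinearMap.sub_apply, LinearMap.smul_apply, LinearMap.id_apply]
      rw [Gop_apply, mul_sub, mul_smul_comm]
      module
  refine key l ?_
  induction l with
  | zero =>
    rintro i _ ⟨c, rfl⟩
    rw [Cas_apply, hψ, map_smul, hψ]
    have : (3:ℝ) • (3:ℝ) • ψ c - (2:ℝ) • (3:ℝ) • ψ c - (3:ℝ) • ψ c - (4 * ((0:ℕ):ℝ) * ((0:ℕ) + 2)) • ψ c = 0 := by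
      push_cast; module
    rw [this]; simp
  | succ l ih =>
    intro i f hf
    have := Wn_y _ i (key l ih f hf)
    convert this using 4
    push_cast; ring

/-- decomposition -/
def Dec (A : S →ₗ[ℝ] S) (V : Submodule ℝ S) (M : Finset ℤ) (f : S) : Prop :=
  ∃ g : ℤ → S, (∀ m ∈ M, g m ∈ V ∧ A (g m) = (m:ℝ) • g m) ∧ f = ∑ m ∈ M, g m

theorem Dec_step {V : Submodule ℝ S} {M : Finset ℤ} {f : S} (hf : f ∈ V)
   (a : ℤ) (ha : a ∉ M) (h : Dec A V M (A f - (a:ℝ) • f)) : Dec A V (insert a M) f := by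
  classical
  obtain ⟨g, hg, hs⟩ := h
  have hne : ∀ m ∈ M, ((m:ℝ) - a) ≠ 0 := fun m hm h0 => ha (by
    have : (m:ℝ) = a := by linarith
    have : m = a := by exact_mod_cast this
    rwa [← this])
  set k := ∑ m ∈ M, ((m:ℝ)-a)⁻¹ • g m with hk
  have hkV : k ∈ V := Submodule.sum_mem _ fun m hm => Submodule.smul_mem _ _ (hg m hm).1
  have hAk : A k - (a:ℝ) • k = A f - (a:ℝ) • f := by
    rw [hs, hk, map_sum, Finset.smul_sum, ← Finset.sum_sub_distrib]
    refine Finset.sum_congr rfl fun m hm => ?_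
    rw [map_smul, (hg m hm).2, smul_smul, smul_smul, ← sub_smul]
    have : ((m:ℝ) - a)⁻¹ * m - a * ((m:ℝ)-a)⁻¹ = 1 := by
      have := hne m hm
      field_simp
    rw [this, one_smul]
  refine ⟨fun m => if m = a then f - k else ((m:ℝ)-a)⁻¹ • g m, fun m hm => ?_, ?_⟩
  · by_cases hma : m = a
    · subst hma
      simp only [if_true]
      refine ⟨sub_mem hf hkV, ?_⟩
      rw [map_sub, smul_sub]
      rw [sub_eq_sub_iff_sub_eq_sub] at hAk
      rw [sub_eq_sub_iff_sub_eq_sub, ← sub_eq_zero]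
      rw [← sub_eq_zero] at hAk
      rw [← neg_eq_zero, ← hAk]; abel
    · simp only [hma, if_false]
      have hm' := (Finset.mem_insert.1 hm).resolve_left hma
      refine ⟨Submodule.smul_mem _ _ (hg m hm').1, ?_⟩
      rw [map_smul, (hg m hm').2, smul_comm]
  · rw [Finset.sum_insert ha]
    simp only [if_true]
    have : ∑ m ∈ M, (if m = a then f - k else ((m:ℝ)-a)⁻¹ • g m) = k := by
      rw [hk]
      refine Finset.sum_congr rfl fun m hm => ?_
      rw [if_neg]; rintro rfl; exact ha hm
    rw [this]; abel

theorem Wn_dec (hyc : ∀ i f, y i * f = f * y i) (hA : ∀ i f, A (y i * f) = y i * A f + γ i * f)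
    (hγψ : ∀ i c, γ i * ψ c ∈ Wn y ψ 1)
    (hψ : ∀ c, A (ψ c) = (3:ℝ) • ψ c)
    (hγ : ∀ i j, γ i * γ j + γ j * γ i = (8:ℝ) • (y i * y j) - (if i = j then (8:ℝ) else 0) • 1)
    (h0 : ∀ i c, Gop A (y i) (ψ c) = (12:ℝ) • (y i * ψ c)) (V : Submodule ℝ S)
    (hV : ∀ f ∈ V, A f ∈ V) (hWV : ∀ n, Wn y ψ n ≤ V) (l : ℕ) :
    ∃ M : Finset ℤ, (∀ m ∈ M, Odd m ∧ 3 ≤ |m| ∧ m < 2*l+4 ∧ -(2*l+2) < m) ∧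
      ∀ f ∈ Wn y ψ l, Dec A V M f := by
  classical
  induction l with
  | zero =>
    refine ⟨{3}, by simp; decide, ?_⟩
    rintro _ ⟨c, rfl⟩
    refine ⟨fun _ => ψ c, ?_, by simp⟩
    intro m hm
    rw [Finset.mem_singleton] at hm
    subst hm
    exact ⟨hWV 0 ⟨c, rfl⟩, by rw [hψ]; norm_num⟩
  | succ l ih =>
    obtain ⟨M, hM, hd⟩ := ih
    have n1 : (2*l+5 : ℤ) ∉ M := fun h => by have := hM _ h; omega
    have n2 : (-(2*l+3) : ℤ) ∉ insert (2*l+5 : ℤ) M := fun h => by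
      rcases Finset.mem_insert.1 h with h | h
      · omega
      · have := hM _ h; omega
    refine ⟨insert (-(2*l+3) : ℤ) (insert (2*l+5 : ℤ) M), ?_, ?_⟩
    · intro m hm
      rw [Finset.mem_insert, Finset.mem_insert] at hm
      rcases hm with rfl | rfl | hm
      · refine ⟨⟨-l-2, by ring⟩, ?_, by push_cast; omega, by push_cast; omega⟩
        rw [abs_neg, abs_of_nonneg] <;> omega
      · refine ⟨⟨l+2, by ring⟩, ?_, by push_cast; omega, by push_cast; omega⟩
        rw [abs_of_nonneg] <;> omega
      · obtain ⟨a, b, c, d⟩ := hM _ hm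
        exact ⟨a, b, by push_cast; omega, by push_cast; omega⟩
    · intro f hf
      have hfV := hWV _ hf
      refine Dec_step hfV _ n2 ?_
      refine Dec_step (sub_mem (hV _ hfV) (Submodule.smul_mem _ _ hfV)) _ n1 ?_
      have := hd _ (Cas_claim hyc hA hγψ hψ hγ h0 l f hf)
      convert this using 1
      rw [Cas_apply, map_sub, map_smul]
      push_cast
      module

end PartII

end
end

section
noncomputable section
/-- eigenvalue -/
def muv (m : ℝ) : ℕ → ℝ
  | 0 => m
  | r+1 => muv m r * (m^2 - 4 * ((r:ℝ)+1)^2)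

theorem muv_neg (m : ℝ) (r : ℕ) : muv (-m) r = - muv m r := by
  induction r with
  | zero => rfl
  | succ r ih => simp only [muv, ih]; ring

theorem muv_shift (m : ℝ) (r : ℕ) : muv (m+2) r * (m - 2*r) = muv m r * (m+2+2*r) := by
  induction r with
  | zero => simp [muv]; ring
  | succ r ih =>
    simp only [muv]; push_cast
    linear_combination (m+2*r+4)*(m-2*r-2) * ih

theorem muv_three (r : ℕ) : |muv 3 r| = (∏ j ∈ Finset.range (r + 1), ((3 : ℝ) + 2 * j)) *
          ∏ j ∈ Finset.Icc 1 r, |2 * (j : ℝ) - 3| := by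
  induction r with
  | zero => simp [muv]
  | succ r ih =>
    rw [Finset.prod_range_succ, Finset.prod_Icc_succ_top (by omega)]
    simp only [muv]
    rw [abs_mul, ih]
    have : (3:ℝ)^2 - 4*((r:ℝ)+1)^2 = -((3 + 2 * ((r+1:ℕ):ℝ)) * (2 * ((r+1:ℕ):ℝ) - 3)) := by
      push_cast; ring
    rw [this, abs_neg, abs_mul, abs_of_nonneg (by positivity : (0:ℝ) ≤ 3 + 2 * ((r+1:ℕ):ℝ))]
    ring

theorem muv_ge_aux (r n : ℕ) : |muv 3 r| ≤ |muv (3 + 2*n) r| := by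
  induction n with
  | zero => simp
  | succ n ih =>
    refine ih.trans ?_
    have h := muv_shift (3+2*n) r
    have e : (3:ℝ) + 2*((n+1:ℕ):ℝ) = 3+2*n+2 := by push_cast; ring
    rw [e]
    have hne : (3+2*(n:ℝ) - 2*r) ≠ 0 := by
      intro h0
      have : (3+2*(n:ℤ) - 2*r) = 0 := by exact_mod_cast h0
      omega
    have h2 : |3+2*(n:ℝ) - 2*r| ≤ |3+2*(n:ℝ)+2+2*r| := by
      rw [abs_of_nonneg (by positivity : (0:ℝ) ≤ 3+2*(n:ℝ)+2+2*r), abs_le]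
      have : (0:ℝ) ≤ n := by positivity
      have : (0:ℝ) ≤ r := by positivity
      constructor <;> linarith
    have h3 := congrArg abs h
    rw [abs_mul, abs_mul] at h3
    have hp := abs_pos.2 hne
    refine le_of_mul_le_mul_right ?_ hp
    rw [h3]
    exact mul_le_mul_of_nonneg_left h2 (abs_nonneg _)

theorem muv_ge (r : ℕ) (m : ℤ) (hm : Odd m) (h3 : 3 ≤ |m|) : |muv 3 r| ≤ |muv m r| := by
  have key : ∀ m : ℤ, Odd m → 3 ≤ m → |muv 3 r| ≤ |muv m r| := by
    rintro m ⟨k, rfl⟩ h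
    obtain ⟨n, hn⟩ := Int.eq_ofNat_of_zero_le (show 0 ≤ k - 1 by omega)
    have := muv_ge_aux r n
    have e : ((2*k+1 : ℤ):ℝ) = 3 + 2*n := by
      have : k = n + 1 := by omega
      rw [this]; push_cast; ring
    rwa [e]
  rcases le_total 0 m with h | h
  · exact key m hm (by rwa [abs_of_nonneg h] at h3)
  · have := key (-m) hm.neg (by rwa [abs_of_nonpos h] at h3)
    rwa [Int.cast_neg, muv_neg, abs_neg] at this

theorem muv_three_pos (r : ℕ) : 0 < |muv 3 r| := by
  rw [muv_three]
  refine mul_pos (Finset.prod_pos fun j _ => by positivity) (Finset.prod_pos fun j _ => ?_)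
  rw [abs_pos]
  intro h0
  have : (2*(j:ℤ) - 3) = 0 := by exact_mod_cast h0
  omega

/-- abstract conclusion -/
theorem abstract_concl {V : Type*} [AddCommGroup V] [Module ℝ V] (b : V →ₗ[ℝ] V →ₗ[ℝ] ℝ)
    (hsymm : ∀ f g, b f g = b g f) (hpos : ∀ f, 0 ≤ b f f) (u t : V) (c : ℝ) (hc : 0 < c)
    (H : ∀ ε > 0, ∃ (M : Finset ℤ) (g : ℤ → V) (μ : ℤ → ℝ), (∀ m ∈ M, c ≤ |μ m|) ∧
      (∀ m ∈ M, ∀ n ∈ M, m ≠ n → b (g m) (g n) = 0) ∧ (∀ m ∈ M, b t (g m) = μ m * b u (g m)) ∧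
      b (u - ∑ m ∈ M, g m) (u - ∑ m ∈ M, g m) ≤ ε) : c * √(b u u) ≤ √(b t t) := by
  have CS : ∀ f g, b f g ≤ √(b f f) * √(b g g) := by
    intro f g
    rw [← Real.sqrt_mul (hpos f)]
    refine Real.le_sqrt_of_sq_le ?_
    have := discrim_le_zero (a := b g g) (b := 2 * b f g) (c := b f f) (fun s => by
      have := hpos (f + s • g)
      simp only [map_add, LinearMap.add_apply, map_smul, LinearMap.smul_apply, smul_eq_mul, hsymm g f] at this
      nlinarith)
    rw [discrim] at this
    nlinarith
  by_cases hu : b u u = 0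
  · rw [hu]; simp
  have hU : 0 < √(b u u) := Real.sqrt_pos.2 (lt_of_le_of_ne (hpos u) (Ne.symm hu))
  have main : ∀ δ > 0, c * (√(b u u) - δ) * √(b u u) ≤ √(b t t) * (√(b u u) + δ) := by
    intro δ hδ
    obtain ⟨M, g, μ, h1, h2, h3, h4⟩ := H (δ^2) (by positivity)
    set G := ∑ m ∈ M, g m with hG
    set v := ∑ m ∈ M, (μ m)⁻¹ • g m with hv
    have hpyth : ∀ a : ℤ → ℝ, b (∑ m ∈ M, a m • g m) (∑ m ∈ M, a m • g m) = ∑ m ∈ M, (a m)^2 * b (g m) (g m) := by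
      intro a
      simp only [map_sum, LinearMap.sum_apply, map_smul, LinearMap.smul_apply, smul_eq_mul]
      refine Finset.sum_congr rfl fun m hm => ?_
      rw [Finset.sum_eq_single m]
      · ring
      · intro n hn hnm; rw [h2 n hn m hm hnm]; simp
      · exact fun h => absurd hm h
    have hμ : ∀ m ∈ M, μ m ≠ 0 := fun m hm h0 => by
      have := h1 m hm; rw [h0, abs_zero] at this; linarith
    have hvv : c^2 * b v v ≤ b G G := by
      have e := hpyth (fun _ => 1)
      simp only [one_smul, one_pow, one_mul] at e
      rw [hv, hpyth, hG, e, Finset.mul_sum]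
      refine Finset.sum_le_sum fun m hm => ?_
      rw [← mul_assoc]
      have h5 : c^2 * (μ m)⁻¹^2 ≤ 1 := by
        have : c^2 ≤ (μ m)^2 := by rw [← sq_abs (μ m)]; exact pow_le_pow_left₀ hc.le (h1 m hm) 2
        rw [inv_pow, ← div_eq_mul_inv]
        exact div_le_one_of_le₀ this (sq_nonneg _)
      nlinarith [hpos (g m)]
    have htv : b t v = b u G := by
      rw [hv, hG, map_sum, map_sum]
      refine Finset.sum_congr rfl fun m hm => ?_
      rw [map_smul, h3 m hm, smul_eq_mul, inv_mul_cancel_left₀ (hμ m hm)]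
    have hd : √(b (u - G) (u - G)) ≤ δ := Real.sqrt_le_iff.2 ⟨hδ.le, h4⟩
    have hG2 : √(b G G) ≤ √(b u u) + δ := by
      refine Real.sqrt_le_iff.2 ⟨by positivity, ?_⟩
      have e1 := CS (G - u) u
      have e2 : b (G - u) (G - u) = b (u - G) (u - G) := by
        simp only [map_sub, LinearMap.sub_apply]; ring
      have e3 : b G G = b (G-u) (G-u) + 2 * b (G-u) u + b u u := by
        simp only [map_sub, LinearMap.sub_apply, hsymm u G]; ring
      rw [e2] at e1
      rw [e3, e2]
      have := Real.sq_sqrt (hpos u)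
      nlinarith [mul_le_mul_of_nonneg_right hd hU.le]
    have huG : √(b u u) * (√(b u u) - δ) ≤ b u G := by
      have e1 := CS (u - G) u
      have e3 : b u G = b u u - b (u - G) u := by
        simp only [map_sub, LinearMap.sub_apply, hsymm u G]; ring
      rw [e3]
      have := Real.mul_self_sqrt (hpos u)
      nlinarith [mul_le_mul_of_nonneg_right hd hU.le]
    have hcv : c * √(b v v) ≤ √(b G G) := by
      refine Real.le_sqrt_of_sq_le ?_
      rw [mul_pow, Real.sq_sqrt (hpos v)]; exact hvv
    calc c * (√(b u u) - δ) * √(b u u) = c * (√(b u u) * (√(b u u) - δ)) := by ring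
      _ ≤ c * (√(b t t) * √(b v v)) := by
        refine mul_le_mul_of_nonneg_left (huG.trans ?_) hc.le
        rw [← htv]; exact CS t v
      _ = √(b t t) * (c * √(b v v)) := by ring
      _ ≤ _ := mul_le_mul_of_nonneg_left (hcv.trans hG2) (Real.sqrt_nonneg _)
  have lim : c * (√(b u u) - 0) * √(b u u) ≤ √(b t t) * (√(b u u) + 0) := by
    refine le_of_tendsto_of_tendsto (b := nhdsWithin (0:ℝ) (Set.Ioi 0)) (f := fun δ => c * (√(b u u) - δ) * √(b u u))
      (g := fun δ => √(b t t) * (√(b u u) + δ)) ?_ ?_ ?_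
    · exact (Continuous.tendsto (by fun_prop) 0).mono_left nhdsWithin_le_nhds
    · exact (Continuous.tendsto (by fun_prop) 0).mono_left nhdsWithin_le_nhds
    · filter_upwards [self_mem_nhdsWithin] with δ hδ using main δ hδ
  rw [sub_zero, add_zero] at lim
  exact le_of_mul_le_mul_right lim hU

end
end

section
noncomputable section
set_option linter.unusedSimpArgs false
open scoped Quaternion ContDiff

abbrev E3 := EuclideanSpace ℝ (Fin 3)

/-- smooth functions -/
def Sm : Subalgebra ℝ (E3 → ℍ[ℝ]) where
  carrier := {f | ContDiff ℝ ∞ f}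
  mul_mem' := fun {a b} ha hb => by
    have ha' : ContDiff ℝ ∞ a := ha
    have hb' : ContDiff ℝ ∞ b := hb
    exact ha'.mul hb'
  add_mem' := fun {a b} ha hb => by
    have ha' : ContDiff ℝ ∞ a := ha
    have hb' : ContDiff ℝ ∞ b := hb
    exact ha'.add hb'
  algebraMap_mem' := fun r => by
    show ContDiff ℝ ∞ (fun _ => _)
    exact contDiff_const

theorem Sm.cd (f : Sm) : ContDiff ℝ ∞ f.1 := f.2
theorem Sm.diff (f : Sm) : Differentiable ℝ f.1 := (Sm.cd f).differentiable (by simp)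

abbrev bv (a : Fin 3) : E3 := EuclideanSpace.single a 1

/-- partial derivatives -/
def Pd (a : Fin 3) : Sm →ₗ[ℝ] Sm where
  toFun f := ⟨fun x => fderiv ℝ f.1 x (bv a), by
    have : ContDiff ℝ ∞ (fderiv ℝ f.1) := (Sm.cd f).fderiv_right (by simp)
    exact (show ContDiff ℝ ∞ (fun x => fderiv ℝ f.1 x (bv a)) from this.clm_apply contDiff_const)⟩
  map_add' f g := by
    ext1; funext x
    change fderiv ℝ (f.1 + g.1) x (bv a) = _
    rw [fderiv_add (Sm.diff f x) (Sm.diff g x)]; rfl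
  map_smul' c f := by
    ext1; funext x
    change fderiv ℝ (c • f.1) x (bv a) = _
    rw [fderiv_const_smul (Sm.diff f x)]; rfl

theorem Pd_apply (a : Fin 3) (f : Sm) (x : E3) : (Pd a f).1 x = fderiv ℝ f.1 x (bv a) := rfl

theorem Pd_mul (a : Fin 3) (f g : Sm) : Pd a (f * g) = Pd a f * g + f * Pd a g := by
  ext1; funext x
  change fderiv ℝ (f.1 * g.1) x (bv a) = fderiv ℝ f.1 x (bv a) * g.1 x + f.1 x * fderiv ℝ g.1 x (bv a)
  rw [fderiv_mul' (Sm.diff f x) (Sm.diff g x)]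
  simp [add_comm]

theorem Pd_comm (a b : Fin 3) (f : Sm) : Pd a (Pd b f) = Pd b (Pd a f) := by
  ext1; funext x
  have h : ∀ v w : E3, fderiv ℝ (fun x => fderiv ℝ f.1 x v) x w = fderiv ℝ (fderiv ℝ f.1) x w v := by
    intro v w
    have hd : DifferentiableAt ℝ (fderiv ℝ f.1) x :=
      (((Sm.cd f).fderiv_right (m := ∞) (by simp)).differentiable (by simp)) x
    rw [fderiv_clm_apply hd (differentiableAt_const v)]
    simp
  change fderiv ℝ (fun x => fderiv ℝ f.1 x (bv b)) x (bv a) = fderiv ℝ (fun x => fderiv ℝ f.1 x (bv a)) x (bv b)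
  rw [h, h]
  have : IsSymmSndFDerivAt ℝ f.1 x :=
    ((Sm.cd f).contDiffAt).isSymmSndFDerivAt (by simp; exact WithTop.coe_le_coe.2 le_top)
  exact this _ _

/-- constants -/
def cst (c : ℍ[ℝ]) : Sm := ⟨fun _ => c, show ContDiff ℝ ∞ (fun _ => c) from contDiff_const⟩

theorem Pd_cst (a) (c : ℍ[ℝ]) : Pd a (cst c) = 0 := by
  ext1; funext x
  change fderiv ℝ (fun _ => c) x (bv a) = 0
  simp

/-- real functions -/
def rl (φ : E3 → ℝ) (h : ContDiff ℝ ∞ φ) : Sm :=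
  ⟨fun x => (φ x : ℍ[ℝ]), show ContDiff ℝ ∞ ((algebraMapCLM ℝ ℍ[ℝ]) ∘ φ) from (algebraMapCLM ℝ ℍ[ℝ]).contDiff.comp h⟩

theorem rl_central (φ : E3 → ℝ) (h : ContDiff ℝ ∞ φ) (f : Sm) : rl φ h * f = f * rl φ h := by
  ext1; funext x
  exact Quaternion.coe_commutes _ _

theorem Pd_rl (a) (φ : E3 → ℝ) (h : ContDiff ℝ ∞ φ) (φ' : E3 →L[ℝ] ℝ) (x : E3) (hd : HasFDerivAt φ φ' x) :
    (Pd a (rl φ h)).1 x = ((φ' (bv a) : ℝ) : ℍ[ℝ]) := by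
  have := ((algebraMapCLM ℝ ℍ[ℝ]).hasFDerivAt (x := φ x)).comp x hd
  rw [Pd_apply]
  have e : (rl φ h).1 = (algebraMapCLM ℝ ℍ[ℝ]) ∘ φ := rfl
  rw [e, this.fderiv]
  rfl

/-- coordinates -/
def xc (b : Fin 3) : Sm := rl (fun x => x b) (by fun_prop)

theorem Pd_xc (a b) (x : E3) : (Pd a (xc b)).1 x = if a = b then 1 else 0 := by
  have hd : HasFDerivAt (fun x : E3 => x b) (EuclideanSpace.proj b : E3 →L[ℝ] ℝ) x :=
    (EuclideanSpace.proj b : E3 →L[ℝ] ℝ).hasFDerivAt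
  rw [xc, Pd_rl _ _ _ _ x hd]
  by_cases h : a = b
  · simp [h]
  · simp [h, Ne.symm h]

/-- weight -/
def Jr (x : E3) : ℝ := 1 + ‖x‖^2

theorem Jr_eq (x : E3) : Jr x = 1 + (x 0 ^2 + x 1 ^2 + x 2 ^2) := by
  rw [Jr, EuclideanSpace.real_norm_sq_eq, Fin.sum_univ_three]

theorem Jr_pos (x : E3) : 0 < Jr x := by unfold Jr; positivity
theorem Jr_one_le (x : E3) : 1 ≤ Jr x := by unfold Jr; nlinarith [sq_nonneg ‖x‖]

theorem Jr_smooth : ContDiff ℝ ∞ Jr := contDiff_const.add (contDiff_norm_sq ℝ)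

theorem Jr_deriv (x : E3) : HasFDerivAt Jr ((2:ℝ) • innerSL ℝ x) x := by
  have := (hasStrictFDerivAt_norm_sq (F := E3) x).hasFDerivAt.const_add (1:ℝ)
  have e : (2:ℝ) • innerSL ℝ x = 2 • innerSL ℝ x := by rw [two_smul, two_smul]
  rw [e]; exact this

theorem inner_bv (x : E3) (a : Fin 3) : inner ℝ x (bv a) = x a := by
  simp [EuclideanSpace.inner_single_right]

/-- weight -/
def Jf : Sm := rl Jr Jr_smooth

theorem Jf_apply (x : E3) : Jf.1 x = (Jr x : ℍ[ℝ]) := rfl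
theorem Pd_Jf (a) (x : E3) : (Pd a Jf).1 x = ((2 * x a : ℝ) : ℍ[ℝ]) := by
  rw [Jf, Pd_rl _ _ _ _ x (Jr_deriv x)]
  simp [inner_bv]

theorem Jp_smooth (s : ℝ) : ContDiff ℝ ∞ (fun x => Jr x ^ s) :=
  Jr_smooth.rpow_const_of_ne (fun x => (Jr_pos x).ne')

/-- real power -/
def Jp (s : ℝ) : Sm := rl (fun x => Jr x ^ s) (Jp_smooth s)

theorem Pd_Jp (s : ℝ) (a) (x : E3) : (Pd a (Jp s)).1 x = ((2 * s * x a * (Jr x)⁻¹ * Jr x ^ s : ℝ) : ℍ[ℝ]) := by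
  have hd := (Jr_deriv x).rpow_const (p := s) (Or.inl (Jr_pos x).ne')
  rw [Jp, Pd_rl _ _ _ _ x hd]
  congr 1
  simp only [smul_apply, innerSL_apply_apply, inner_bv, smul_eq_mul]
  rw [Real.rpow_sub_one (Jr_pos x).ne']
  field_simp

/-- inverse weight -/
def Ji : Sm := rl (fun x => (Jr x)⁻¹) (Jr_smooth.inv (fun x => (Jr_pos x).ne'))

theorem Ji_apply (x : E3) : Ji.1 x = ((Jr x)⁻¹ : ℝ) := rfl
theorem Pd_Ji (a) (x : E3) : (Pd a Ji).1 x = ((- 2 * x a * (Jr x)⁻¹ ^2 : ℝ) : ℍ[ℝ]) := by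
  have hd : HasFDerivAt (fun x => (Jr x)⁻¹) _ x := (hasDerivAt_inv (Jr_pos x).ne').comp_hasFDerivAt x (Jr_deriv x)
  rw [Ji, Pd_rl _ _ _ _ x hd]
  congr 1
  simp only [smul_apply, innerSL_apply_apply, inner_bv, smul_eq_mul]
  field_simp

theorem JJi : Jf * Ji = 1 := by
  ext1; funext x
  change (Jr x : ℍ[ℝ]) * (((Jr x)⁻¹ : ℝ) : ℍ[ℝ]) = 1
  rw [← Quaternion.coe_mul, mul_inv_cancel₀ (Jr_pos x).ne']; rfl

/-- vector variable -/
def Xs : Sm := xc 0 * cst qI + xc 1 * cst qJ + xc 2 * cst qK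

/-- Dirac -/
def Dop : Sm →ₗ[ℝ] Sm := LinearMap.mulLeft ℝ (cst qI) ∘ₗ Pd 0 + LinearMap.mulLeft ℝ (cst qJ) ∘ₗ Pd 1
  + LinearMap.mulLeft ℝ (cst qK) ∘ₗ Pd 2

theorem Dop_apply (f : Sm) : Dop f = cst qI * Pd 0 f + cst qJ * Pd 1 f + cst qK * Pd 2 f := rfl

theorem Dop_coe (f : Sm) : (Dop f).1 = diracQ f.1 := rfl

/-- Euler -/
def Uop : Sm →ₗ[ℝ] Sm := LinearMap.mulLeft ℝ (xc 0) ∘ₗ Pd 0 + LinearMap.mulLeft ℝ (xc 1) ∘ₗ Pd 1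
  + LinearMap.mulLeft ℝ (xc 2) ∘ₗ Pd 2

theorem Uop_apply (f : Sm) : Uop f = xc 0 * Pd 0 f + xc 1 * Pd 1 f + xc 2 * Pd 2 f := rfl

@[simp] theorem qI_re : qI.re = 0 := rfl
@[simp] theorem qI_i : qI.imI = 1 := rfl
@[simp] theorem qI_j : qI.imJ = 0 := rfl
@[simp] theorem qI_k : qI.imK = 0 := rfl
@[simp] theorem qJ_re : qJ.re = 0 := rfl
@[simp] theorem qJ_i : qJ.imI = 0 := rfl
@[simp] theorem qJ_j : qJ.imJ = 1 := rfl
@[simp] theorem qJ_k : qJ.imK = 0 := rfl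
@[simp] theorem qK_re : qK.re = 0 := rfl
@[simp] theorem qK_i : qK.imI = 0 := rfl
@[simp] theorem qK_j : qK.imJ = 0 := rfl
@[simp] theorem qK_k : qK.imK = 1 := rfl

theorem mul_ap (f g : Sm) (x) : (f * g).1 x = f.1 x * g.1 x := rfl
theorem add_ap (f g : Sm) (x) : (f + g).1 x = f.1 x + g.1 x := rfl
theorem sub_ap (f g : Sm) (x) : (f - g).1 x = f.1 x - g.1 x := rfl
theorem neg_ap (f : Sm) (x) : (- f).1 x = - f.1 x := rfl
theorem smul_ap (c : ℝ) (f : Sm) (x) : (c • f).1 x = c • f.1 x := rfl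
theorem one_ap (x) : (1 : Sm).1 x = 1 := rfl
theorem cst_ap (c : ℍ[ℝ]) (x) : (cst c).1 x = c := rfl
theorem xc_ap (b : Fin 3) (x) : (xc b).1 x = ((x b : ℝ) : ℍ[ℝ]) := rfl

theorem Pd_Xs (a) : Pd a Xs = cst (![qI, qJ, qK] a) := by
  ext1; funext x
  simp only [Xs, map_add, Pd_mul, Pd_cst, mul_zero, add_zero, add_ap, mul_ap, Pd_xc, cst_ap]
  fin_cases a <;> simp

theorem Pd_Xs0 : Pd 0 Xs = cst qI := Pd_Xs 0
theorem Pd_Xs1 : Pd 1 Xs = cst qJ := Pd_Xs 1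
theorem Pd_Xs2 : Pd 2 Xs = cst qK := Pd_Xs 2
theorem Xs_ap (x : E3) : Xs.1 x = ((x 0 : ℝ) : ℍ[ℝ]) * qI + ((x 1 : ℝ) : ℍ[ℝ]) * qJ + ((x 2 : ℝ) : ℍ[ℝ]) * qK := rfl

theorem Sm_ext {f g : Sm} (h : ∀ x, f.1 x = g.1 x) : f = g := Subtype.ext (funext h)

theorem r1 : (Dop * LinearMap.mulLeft ℝ Xs + LinearMap.mulLeft ℝ Xs * Dop : Module.End ℝ Sm) = -3 - 2 * Uop := by
  refine LinearMap.ext fun f => Sm_ext fun x => ?_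
  have : (-3 - 2 * Uop : Module.End ℝ Sm) f = - ((3:ℝ) • f) - (2:ℝ) • Uop f := by
    have e3 : (3 : Module.End ℝ Sm) = (3:ℝ) • 1 := by
      rw [← Algebra.algebraMap_eq_smul_one]; exact (map_ofNat (algebraMap ℝ (Module.End ℝ Sm)) _).symm
    have e2 : (2 : Module.End ℝ Sm) = (2:ℝ) • 1 := by
      rw [← Algebra.algebraMap_eq_smul_one]; exact (map_ofNat (algebraMap ℝ (Module.End ℝ Sm)) _).symm
    rw [e3, e2]; simp
  rw [this]
  simp only [LinearMap.add_apply, Module.End.mul_apply, LinearMap.mulLeft_apply, Dop_apply, Uop_apply, Pd_mul, Pd_Xs0, Pd_Xs1, Pd_Xs2,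
    mul_ap, add_ap, sub_ap, neg_ap, smul_ap, cst_ap, xc_ap, Xs_ap]
  ext <;> simp only [Quaternion.re_mul, Quaternion.imI_mul, Quaternion.imJ_mul, Quaternion.imK_mul, Quaternion.re_add, Quaternion.imI_add, Quaternion.imJ_add, Quaternion.imK_add, Quaternion.re_sub, Quaternion.imI_sub, Quaternion.imJ_sub, Quaternion.imK_sub, Quaternion.re_neg, Quaternion.imI_neg, Quaternion.imJ_neg, Quaternion.imK_neg, Quaternion.re_smul, Quaternion.imI_smul, Quaternion.imJ_smul, Quaternion.imK_smul, Quaternion.re_coe, Quaternion.imI_coe, Quaternion.imJ_coe, Quaternion.imK_coe, Quaternion.re_one, Quaternion.imI_one, Quaternion.imJ_one, Quaternion.imK_one, Quaternion.re_zero, Quaternion.imI_zero, Quaternion.imJ_zero, Quaternion.imK_zero, qI_re, qI_i, qI_j, qI_k, qJ_re, qJ_i, qJ_j, qJ_k, qK_re, qK_i, qK_j, qK_k, smul_eq_mul, zero_mul, mul_zero, mul_one, one_mul, add_zero, zero_add, sub_zero, zero_sub, neg_zero] <;> ring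

theorem r2 : (Dop * LinearMap.mulLeft ℝ Jf : Module.End ℝ Sm) = LinearMap.mulLeft ℝ Jf * Dop + 2 * LinearMap.mulLeft ℝ Xs := by
  refine LinearMap.ext fun f => Sm_ext fun x => ?_
  have : (LinearMap.mulLeft ℝ Jf * Dop + 2 * LinearMap.mulLeft ℝ Xs : Module.End ℝ Sm) f = Jf * Dop f + (2:ℝ) • (Xs * f) := by
    have e2 : (2 : Module.End ℝ Sm) = (2:ℝ) • 1 := by
      rw [← Algebra.algebraMap_eq_smul_one]; exact (map_ofNat (algebraMap ℝ (Module.End ℝ Sm)) _).symm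
    rw [e2]; simp
  rw [this]
  simp only [LinearMap.add_apply, Module.End.mul_apply, LinearMap.mulLeft_apply, Dop_apply, Uop_apply, Pd_mul, Pd_Jf,
    mul_ap, add_ap, sub_ap, neg_ap, smul_ap, cst_ap, xc_ap, Xs_ap, Jf_apply]
  ext <;> simp only [Quaternion.re_mul, Quaternion.imI_mul, Quaternion.imJ_mul, Quaternion.imK_mul, Quaternion.re_add, Quaternion.imI_add, Quaternion.imJ_add, Quaternion.imK_add, Quaternion.re_sub, Quaternion.imI_sub, Quaternion.imJ_sub, Quaternion.imK_sub, Quaternion.re_neg, Quaternion.imI_neg, Quaternion.imJ_neg, Quaternion.imK_neg, Quaternion.re_smul, Quaternion.imI_smul, Quaternion.imJ_smul, Quaternion.imK_smul, Quaternion.re_coe, Quaternion.imI_coe, Quaternion.imJ_coe, Quaternion.imK_coe, Quaternion.re_one, Quaternion.imI_one, Quaternion.imJ_one, Quaternion.imK_one, Quaternion.re_zero, Quaternion.imI_zero, Quaternion.imJ_zero, Quaternion.imK_zero, qI_re, qI_i, qI_j, qI_k, qJ_re, qJ_i, qJ_j, qJ_k, qK_re, qK_i, qK_j, qK_k, smul_eq_mul,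 zero_mul, mul_zero, mul_one, one_mul, add_zero, zero_add, sub_zero, zero_sub, neg_zero] <;> ring

theorem r3 : (Dop * Uop : Module.End ℝ Sm) = Uop * Dop + Dop := by
  refine LinearMap.ext fun f => Sm_ext fun x => ?_
  simp only [LinearMap.add_apply, Module.End.mul_apply, LinearMap.mulLeft_apply, Dop_apply, Uop_apply, Pd_mul,
    map_add, Pd_xc, Pd_cst, zero_mul, zero_add,
    mul_ap, add_ap, sub_ap, neg_ap, smul_ap, cst_ap, xc_ap]
  rw [Pd_comm 1 0, Pd_comm 2 0, Pd_comm 2 1]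
  have e01 : ((0 : Fin 3) = 1) = False := by decide
  have e02 : ((0 : Fin 3) = 2) = False := by decide
  have e12 : ((1 : Fin 3) = 2) = False := by decide
  have e10 : ((1 : Fin 3) = 0) = False := by decide
  have e20 : ((2 : Fin 3) = 0) = False := by decide
  have e21 : ((2 : Fin 3) = 1) = False := by decide
  simp only [e01, e02, e12, e10, e20, e21, if_true, if_false, zero_mul, one_mul, zero_add, add_zero]
  generalize (Pd 0 (Pd 0 f)).1 x = f00
  generalize (Pd 0 (Pd 1 f)).1 x = f01
  generalize (Pd 0 (Pd 2 f)).1 x = f02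
  generalize (Pd 1 (Pd 1 f)).1 x = f11
  generalize (Pd 1 (Pd 2 f)).1 x = f12
  generalize (Pd 2 (Pd 2 f)).1 x = f22
  ext <;> simp only [Quaternion.re_mul, Quaternion.imI_mul, Quaternion.imJ_mul, Quaternion.imK_mul, Quaternion.re_add, Quaternion.imI_add, Quaternion.imJ_add, Quaternion.imK_add, Quaternion.re_sub, Quaternion.imI_sub, Quaternion.imJ_sub, Quaternion.imK_sub, Quaternion.re_neg, Quaternion.imI_neg, Quaternion.imJ_neg, Quaternion.imK_neg, Quaternion.re_smul, Quaternion.imI_smul, Quaternion.imJ_smul, Quaternion.imK_smul, Quaternion.re_coe, Quaternion.imI_coe, Quaternion.imJ_coe, Quaternion.imK_coe, Quaternion.re_one, Quaternion.imI_one, Quaternion.imJ_one, Quaternion.imK_one, Quaternion.re_zero, Quaternion.imI_zero, Quaternion.imJ_zero, Quaternion.imK_zero, qI_re, qI_i, qI_j, qI_k, qJ_re, qJ_i, qJ_j, qJ_k, qK_re, qK_i, qK_j, qK_k, smul_eq_mul, zero_mul, mul_zero, mul_one, one_mul, add_zero, zero_add, sub_zero, zero_sub, neg_zero] <;> ring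

theorem r4 : (Uop * LinearMap.mulLeft ℝ Jf : Module.End ℝ Sm) = LinearMap.mulLeft ℝ Jf * Uop + 2 * (LinearMap.mulLeft ℝ Jf - 1) := by
  refine LinearMap.ext fun f => Sm_ext fun x => ?_
  have : (LinearMap.mulLeft ℝ Jf * Uop + 2 * (LinearMap.mulLeft ℝ Jf - 1) : Module.End ℝ Sm) f = Jf * Uop f + (2:ℝ) • (Jf * f - f) := by
    have e2 : (2 : Module.End ℝ Sm) = (2:ℝ) • 1 := by
      rw [← Algebra.algebraMap_eq_smul_one]; exact (map_ofNat (algebraMap ℝ (Module.End ℝ Sm)) _).symm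
    rw [e2]; simp
  rw [this]
  simp only [LinearMap.add_apply, Module.End.mul_apply, LinearMap.mulLeft_apply, Dop_apply, Uop_apply, Pd_mul, Pd_Jf,
    mul_ap, add_ap, sub_ap, neg_ap, smul_ap, cst_ap, xc_ap, Xs_ap, Jf_apply, Jr_eq]
  ext <;> simp only [Quaternion.re_mul, Quaternion.imI_mul, Quaternion.imJ_mul, Quaternion.imK_mul, Quaternion.re_add, Quaternion.imI_add, Quaternion.imJ_add, Quaternion.imK_add, Quaternion.re_sub, Quaternion.imI_sub, Quaternion.imJ_sub, Quaternion.imK_sub, Quaternion.re_neg, Quaternion.imI_neg, Quaternion.imJ_neg, Quaternion.imK_neg, Quaternion.re_smul, Quaternion.imI_smul, Quaternion.imJ_smul, Quaternion.imK_smul, Quaternion.re_coe, Quaternion.imI_coe, Quaternion.imJ_coe, Quaternion.imK_coe, Quaternion.re_one, Quaternion.imI_one, Quaternion.imJ_one, Quaternion.imK_one, Quaternion.re_zero, Quaternion.imI_zero, Quaternion.imJ_zero, Quaternion.imK_zero, qI_re, qI_i, qI_j, qI_k, qJ_re, qJ_i, qJ_j, qJ_k, qK_re, qK_i, qK_j,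 qK_k, smul_eq_mul, zero_mul, mul_zero, mul_one, one_mul, add_zero, zero_add, sub_zero, zero_sub, neg_zero] <;> ring

theorem r5' : Xs * Xs = 1 - Jf := by
  refine Sm_ext fun x => ?_
  simp only [mul_ap, add_ap, sub_ap, cst_ap, xc_ap, Xs_ap, Jf_apply, Jr_eq, one_ap]
  ext <;> simp only [Quaternion.re_mul, Quaternion.imI_mul, Quaternion.imJ_mul, Quaternion.imK_mul, Quaternion.re_add, Quaternion.imI_add, Quaternion.imJ_add, Quaternion.imK_add, Quaternion.re_sub, Quaternion.imI_sub, Quaternion.imJ_sub, Quaternion.imK_sub, Quaternion.re_neg, Quaternion.imI_neg, Quaternion.imJ_neg, Quaternion.imK_neg, Quaternion.re_smul, Quaternion.imI_smul, Quaternion.imJ_smul, Quaternion.imK_smul, Quaternion.re_coe, Quaternion.imI_coe, Quaternion.imJ_coe, Quaternion.imK_coe, Quaternion.re_one, Quaternion.imI_one, Quaternion.imJ_one, Quaternion.imK_one, Quaternion.re_zero, Quaternion.imI_zero, Quaternion.imJ_zero, Quaternion.imK_zero, qI_re, qI_i, qI_j, qI_k, qJ_re, qJ_i, qJ_j, qJ_k,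 qK_re, qK_i, qK_j, qK_k, smul_eq_mul, zero_mul, mul_zero, mul_one, one_mul, add_zero, zero_add, sub_zero, zero_sub, neg_zero] <;> ring

theorem r5 : (LinearMap.mulLeft ℝ Xs * LinearMap.mulLeft ℝ Xs : Module.End ℝ Sm) = 1 - LinearMap.mulLeft ℝ Jf := by
  refine LinearMap.ext fun f => ?_
  simp only [Module.End.mul_apply, LinearMap.mulLeft_apply, ← mul_assoc, r5', LinearMap.sub_apply, Module.End.one_apply, sub_mul, one_mul]

theorem r6 : (LinearMap.mulLeft ℝ Xs * LinearMap.mulLeft ℝ Jf : Module.End ℝ Sm) = LinearMap.mulLeft ℝ Jf * LinearMap.mulLeft ℝ Xs := by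
  refine LinearMap.ext fun f => ?_
  simp only [Module.End.mul_apply, LinearMap.mulLeft_apply, ← mul_assoc]
  rw [Jf, rl_central]
end
end

section
noncomputable section
set_option linter.unusedSimpArgs false
open scoped Quaternion ContDiff

theorem Jinv_smooth : ContDiff ℝ ∞ (fun x : E3 => (Jr x)⁻¹) := Jr_smooth.inv (fun x => (Jr_pos x).ne')

/-- Sphere coordinates. -/
def yv : Fin 4 → E3 → ℝ := ![fun x => 2 * (Jr x)⁻¹ - 1, fun x => 2 * (x 0 * (Jr x)⁻¹), fun x => 2 * (x 1 * (Jr x)⁻¹),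
  fun x => 2 * (x 2 * (Jr x)⁻¹)]

theorem coord_smooth (a : Fin 3) : ContDiff ℝ ∞ (fun x : E3 => 2 * (x a * (Jr x)⁻¹)) := by
  have h : ContDiff ℝ ∞ (fun x : E3 => x a) := by fun_prop
  exact contDiff_const.mul (h.mul Jinv_smooth)

theorem yv_smooth (i : Fin 4) : ContDiff ℝ ∞ (yv i) := by
  fin_cases i
  · exact (contDiff_const.mul Jinv_smooth).sub contDiff_const
  · exact coord_smooth 0
  · exact coord_smooth 1
  · exact coord_smooth 2

/-- Sphere coordinates as smooth functions. -/
def yS (i : Fin 4) : Sm := rl (yv i) (yv_smooth i)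

theorem yS_ap (i x) : (yS i).1 x = (yv i x : ℍ[ℝ]) := rfl

/-- The operator. -/
def Aop : Sm →ₗ[ℝ] Sm := LinearMap.mulLeft ℝ Jf ∘ₗ Dop

theorem Aop_apply (f : Sm) : Aop f = Jf * Dop f := rfl

theorem Dop_rl (φ) (h : ContDiff ℝ ∞ φ) (f : Sm) : Dop (rl φ h * f) = Dop (rl φ h) * f + rl φ h * Dop f := by
  simp only [Dop_apply, Pd_mul, mul_add, add_mul]
  simp only [← mul_assoc, rl_central φ h (cst _)]
  abel

/-- Symbols. -/
def gS (i : Fin 4) : Sm := Jf * Dop (yS i)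

theorem Aop_y (i : Fin 4) (f : Sm) : Aop (yS i * f) = yS i * Aop f + gS i * f := by
  rw [Aop_apply, yS, Dop_rl, Aop_apply, gS, mul_add, ← mul_assoc, ← mul_assoc Jf (rl _ _), ← rl_central _ _ Jf, add_comm, mul_assoc (rl _ _)]
  rfl

theorem yS0 : yS 0 = (2:ℝ) • Ji - 1 := by
  refine Sm_ext fun x => ?_
  rw [yS_ap, sub_ap, smul_ap, Ji_apply, one_ap]
  ext <;> simp [yv]

theorem yS1 : yS 1 = (2:ℝ) • (xc 0 * Ji) := by
  refine Sm_ext fun x => ?_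
  rw [yS_ap, smul_ap, mul_ap, Ji_apply, xc_ap]
  ext <;> simp [yv]
theorem yS2 : yS 2 = (2:ℝ) • (xc 1 * Ji) := by
  refine Sm_ext fun x => ?_
  rw [yS_ap, smul_ap, mul_ap, Ji_apply, xc_ap]
  ext <;> simp [yv]
theorem yS3 : yS 3 = (2:ℝ) • (xc 2 * Ji) := by
  refine Sm_ext fun x => ?_
  rw [yS_ap, smul_ap, mul_ap, Ji_apply, xc_ap]
  ext <;> simp [yv]

theorem Pd_one (a) : Pd a 1 = 0 := by
  have := Pd_cst a 1
  exact this

/-- explicit symbols -/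
def gv (i : Fin 4) (x : E3) : ℍ[ℝ] :=
  ![-(4 * (Jr x)⁻¹) • Xs.1 x, (2:ℝ) • qI - (4 * x 0 * (Jr x)⁻¹) • Xs.1 x, (2:ℝ) • qJ - (4 * x 1 * (Jr x)⁻¹) • Xs.1 x,
    (2:ℝ) • qK - (4 * x 2 * (Jr x)⁻¹) • Xs.1 x] i

set_option maxHeartbeats 4000000 in
theorem gS_ap (i x) : (gS i).1 x = gv i x := by
  have e01 : ((0 : Fin 3) = 1) = False := by decide
  have e02 : ((0 : Fin 3) = 2) = False := by decide
  have e12 : ((1 : Fin 3) = 2) = False := by decide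
  have e10 : ((1 : Fin 3) = 0) = False := by decide
  have e20 : ((2 : Fin 3) = 0) = False := by decide
  have e21 : ((2 : Fin 3) = 1) = False := by decide
  have hJ := (Jr_pos x).ne'
  rw [gS, mul_ap, Dop_apply]
  match i with
  | 0 =>
    change _ = -(4 * (Jr x)⁻¹) • Xs.1 x
    rw [yS0]
    simp only [map_sub, map_smul, Pd_mul, Pd_one, sub_zero, add_ap, mul_ap, smul_ap, Pd_xc, Pd_Ji, Ji_apply, cst_ap, xc_ap, Jf_apply, Xs_ap, e01, e02, e12, e10, e20, e21, if_true, if_false]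
    ext <;> simp only [Quaternion.re_mul, Quaternion.imI_mul, Quaternion.imJ_mul, Quaternion.imK_mul, Quaternion.re_add, Quaternion.imI_add, Quaternion.imJ_add, Quaternion.imK_add, Quaternion.re_sub, Quaternion.imI_sub, Quaternion.imJ_sub, Quaternion.imK_sub, Quaternion.re_neg, Quaternion.imI_neg, Quaternion.imJ_neg, Quaternion.imK_neg, Quaternion.re_smul, Quaternion.imI_smul, Quaternion.imJ_smul, Quaternion.imK_smul, Quaternion.re_coe, Quaternion.imI_coe, Quaternion.imJ_coe, Quaternion.imK_coe, Quaternion.re_one, Quaternion.imI_one, Quaternion.imJ_one, Quaternion.imK_one, Quaternion.re_zero, Quaternion.imI_zero, Quaternion.imJ_zero, Quaternion.imK_zero, qI_re, qI_i, qI_j, qI_k, qJ_re, qJ_i, qJ_j, qJ_k, qK_re, qK_i, qK_j, qK_k, smul_eq_mul, zero_mul, mul_zero, mul_one, one_mul, add_zero, zero_add, sub_zero, zero_sub, neg_zero] <;> field_simp <;> ring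
  | 1 =>
    change _ = (2:ℝ) • qI - (4 * x 0 * (Jr x)⁻¹) • Xs.1 x
    rw [yS1]
    simp only [map_sub, map_smul, Pd_mul, Pd_one, sub_zero, add_ap, mul_ap, smul_ap, Pd_xc, Pd_Ji, Ji_apply, cst_ap, xc_ap, Jf_apply, Xs_ap, e01, e02, e12, e10, e20, e21, if_true, if_false]
    ext <;> simp only [Quaternion.re_mul, Quaternion.imI_mul, Quaternion.imJ_mul, Quaternion.imK_mul, Quaternion.re_add, Quaternion.imI_add, Quaternion.imJ_add, Quaternion.imK_add, Quaternion.re_sub, Quaternion.imI_sub, Quaternion.imJ_sub, Quaternion.imK_sub, Quaternion.re_neg, Quaternion.imI_neg, Quaternion.imJ_neg, Quaternion.imK_neg, Quaternion.re_smul, Quaternion.imI_smul, Quaternion.imJ_smul, Quaternion.imK_smul, Quaternion.re_coe, Quaternion.imI_coe, Quaternion.imJ_coe, Quaternion.imK_coe, Quaternion.re_one, Quaternion.imI_one, Quaternion.imJ_one, Quaternion.imK_one, Quaternion.re_zero, Quaternion.imI_zero, Quaternion.imJ_zero, Quaternion.imK_zero, qI_re, qI_i, qI_j, qI_k, qJ_re,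 qJ_i, qJ_j, qJ_k, qK_re, qK_i, qK_j, qK_k, smul_eq_mul, zero_mul, mul_zero, mul_one, one_mul, add_zero, zero_add, sub_zero, zero_sub, neg_zero] <;> field_simp <;> ring
  | 2 =>
    change _ = (2:ℝ) • qJ - (4 * x 1 * (Jr x)⁻¹) • Xs.1 x
    rw [yS2]
    simp only [map_sub, map_smul, Pd_mul, Pd_one, sub_zero, add_ap, mul_ap, smul_ap, Pd_xc, Pd_Ji, Ji_apply, cst_ap, xc_ap, Jf_apply, Xs_ap, e01, e02, e12, e10, e20, e21, if_true, if_false]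
    ext <;> simp only [Quaternion.re_mul, Quaternion.imI_mul, Quaternion.imJ_mul, Quaternion.imK_mul, Quaternion.re_add, Quaternion.imI_add, Quaternion.imJ_add, Quaternion.imK_add, Quaternion.re_sub, Quaternion.imI_sub, Quaternion.imJ_sub, Quaternion.imK_sub, Quaternion.re_neg, Quaternion.imI_neg, Quaternion.imJ_neg, Quaternion.imK_neg, Quaternion.re_smul, Quaternion.imI_smul, Quaternion.imJ_smul, Quaternion.imK_smul, Quaternion.re_coe, Quaternion.imI_coe, Quaternion.imJ_coe, Quaternion.imK_coe, Quaternion.re_one, Quaternion.imI_one, Quaternion.imJ_one, Quaternion.imK_one, Quaternion.re_zero, Quaternion.imI_zero, Quaternion.imJ_zero, Quaternion.imK_zero, qI_re, qI_i, qI_j, qI_k, qJ_re, qJ_i, qJ_j, qJ_k, qK_re, qK_i, qK_j, qK_k, smul_eq_mul, zero_mul, mul_zero, mul_one, one_mul, add_zero, zero_add, sub_zero, zero_sub, neg_zero] <;> field_simp <;> ring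
  | 3 =>
    change _ = (2:ℝ) • qK - (4 * x 2 * (Jr x)⁻¹) • Xs.1 x
    rw [yS3]
    simp only [map_sub, map_smul, Pd_mul, Pd_one, sub_zero, add_ap, mul_ap, smul_ap, Pd_xc, Pd_Ji, Ji_apply, cst_ap, xc_ap, Jf_apply, Xs_ap, e01, e02, e12, e10, e20, e21, if_true, if_false]
    ext <;> simp only [Quaternion.re_mul, Quaternion.imI_mul, Quaternion.imJ_mul, Quaternion.imK_mul, Quaternion.re_add, Quaternion.imI_add, Quaternion.imJ_add, Quaternion.imK_add, Quaternion.re_sub, Quaternion.imI_sub, Quaternion.imJ_sub, Quaternion.imK_sub, Quaternion.re_neg, Quaternion.imI_neg, Quaternion.imJ_neg, Quaternion.imK_neg, Quaternion.re_smul, Quaternion.imI_smul, Quaternion.imJ_smul, Quaternion.imK_smul, Quaternion.re_coe, Quaternion.imI_coe, Quaternion.imJ_coe, Quaternion.imK_coe, Quaternion.re_one, Quaternion.imI_one, Quaternion.imJ_one, Quaternion.imK_one, Quaternion.re_zero, Quaternion.imI_zero, Quaternion.imJ_zero, Quaternion.imK_zero, qI_re, qI_i, qI_j, qI_k, qJ_re,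 qJ_i, qJ_j, qJ_k, qK_re, qK_i, qK_j, qK_k, smul_eq_mul, zero_mul, mul_zero, mul_one, one_mul, add_zero, zero_add, sub_zero, zero_sub, neg_zero] <;> field_simp <;> ring

/-- Killing-type sections -/
def psi : ℍ[ℝ] →ₗ[ℝ] Sm where
  toFun c := Jp (-3/2) * (1 - Xs) * cst c
  map_add' c d := by rw [← mul_add]; rfl
  map_smul' c d := by rw [RingHom.id_apply, ← mul_smul_comm]; rfl

theorem psi_apply (c) : psi c = Jp (-3/2) * (1 - Xs) * cst c := rfl

theorem psi_ap (c x) : (psi c).1 x = ((Jr x ^ (-3/2 : ℝ) : ℝ) : ℍ[ℝ]) * (1 - Xs.1 x) * c := rfl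

theorem Xs_sq (x : E3) : Xs.1 x * Xs.1 x = (1 - Jr x) • (1 : ℍ[ℝ]) := by
  have := congrArg (fun f : Sm => f.1 x) r5'
  simp only [mul_ap, sub_ap, one_ap, Jf_apply] at this
  rw [this, sub_smul, one_smul, Algebra.smul_def, mul_one]; rfl

theorem sum_e (s : ℝ) (x : E3) : qI * ((s * x 0 : ℝ) : ℍ[ℝ]) + qJ * ((s * x 1 : ℝ) : ℍ[ℝ]) + qK * ((s * x 2 : ℝ) : ℍ[ℝ]) = s • Xs.1 x := by
  rw [Xs_ap]
  ext <;> simp only [Quaternion.re_mul, Quaternion.imI_mul, Quaternion.imJ_mul, Quaternion.imK_mul, Quaternion.re_add, Quaternion.imI_add, Quaternion.imJ_add, Quaternion.imK_add, Quaternion.re_sub, Quaternion.imI_sub, Quaternion.imJ_sub, Quaternion.imK_sub, Quaternion.re_neg, Quaternion.imI_neg, Quaternion.imJ_neg, Quaternion.imK_neg, Quaternion.re_smul, Quaternion.imI_smul, Quaternion.imJ_smul, Quaternion.imK_smul, Quaternion.re_coe, Quaternion.imI_coe, Quaternion.imJ_coe, Quaternion.imK_coe, Quaternion.re_one, Quaternion.imI_one,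 Quaternion.imJ_one, Quaternion.imK_one, Quaternion.re_zero, Quaternion.imI_zero, Quaternion.imJ_zero, Quaternion.imK_zero, qI_re, qI_i, qI_j, qI_k, qJ_re, qJ_i, qJ_j, qJ_k, qK_re, qK_i, qK_j, qK_k, smul_eq_mul, zero_mul, mul_zero, mul_one, one_mul, add_zero, zero_add, sub_zero, zero_sub, neg_zero] <;> ring

theorem sum_ee (c : ℍ[ℝ]) : qI * (-qI * c) + qJ * (-qJ * c) + qK * (-qK * c) = (3:ℝ) • c := by
  ext <;> simp only [Quaternion.re_mul, Quaternion.imI_mul, Quaternion.imJ_mul, Quaternion.imK_mul, Quaternion.re_add, Quaternion.imI_add, Quaternion.imJ_add, Quaternion.imK_add, Quaternion.re_sub, Quaternion.imI_sub, Quaternion.imJ_sub, Quaternion.imK_sub, Quaternion.re_neg, Quaternion.imI_neg, Quaternion.imJ_neg, Quaternion.imK_neg, Quaternion.re_smul, Quaternion.imI_smul, Quaternion.imJ_smul, Quaternion.imK_smul, Quaternion.re_coe, Quaternion.imI_coe, Quaternion.imJ_coe, Quaternion.imK_coe, Quaternion.re_one, Quaternion.imI_one, Quaternion.imJ_one, Quaternion.imK_one,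 Quaternion.re_zero, Quaternion.imI_zero, Quaternion.imJ_zero, Quaternion.imK_zero, qI_re, qI_i, qI_j, qI_k, qJ_re, qJ_i, qJ_j, qJ_k, qK_re, qK_i, qK_j, qK_k, smul_eq_mul, zero_mul, mul_zero, mul_one, one_mul, add_zero, zero_add, sub_zero, zero_sub, neg_zero] <;> ring

theorem Aop_psi (c) : Aop (psi c) = (3:ℝ) • psi c := by
  refine Sm_ext fun x => ?_
  have hJ := (Jr_pos x).ne'
  rw [Aop_apply, psi_apply, mul_assoc, Jp, Dop_rl]
  change (Jf * (Dop (Jp _) * _ + Jp _ * _)).1 x = _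
  simp only [Dop_apply, Pd_mul, map_sub, Pd_one, Pd_Xs0, Pd_Xs1, Pd_Xs2, Pd_cst, mul_zero, add_zero, zero_sub, mul_ap, add_ap, sub_ap, neg_ap, smul_ap, Pd_Jp, cst_ap, Jf_apply, one_ap]
  change _ = (3:ℝ) • (((Jr x ^ (-3/2 : ℝ) : ℝ) : ℍ[ℝ]) * ((1 - Xs.1 x) * c))
  change (Jr x : ℍ[ℝ]) * (_ + ((Jr x ^ (-3/2 : ℝ) : ℝ) : ℍ[ℝ]) * _) = _
  generalize Jr x ^ (-3/2 : ℝ) = P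
  have e := sum_e (-3 * (Jr x)⁻¹ * P) x
  have e' : ∀ a, -3 * (Jr x)⁻¹ * P * x a = 2 * (-3/2) * x a * (Jr x)⁻¹ * P := fun a => by ring
  rw [e', e', e'] at e
  rw [e, sum_ee]
  simp only [Quaternion.coe_mul_eq_smul, sub_mul, one_mul, mul_sub, smul_mul_assoc]
  rw [← mul_assoc, Xs_sq, smul_mul_assoc, one_mul]
  generalize Xs.1 x * c = w
  match_scalars <;> field_simp <;> ring

/-- structure constants -/
def qq : Fin 4 → Fin 4 → ℍ[ℝ] := ![![0, -((2:ℝ)•qI), -((2:ℝ)•qJ), -((2:ℝ)•qK)], ![(2:ℝ)•qI, 0, -((2:ℝ)•qK), (2:ℝ)•qJ],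
  ![(2:ℝ)•qJ, (2:ℝ)•qK, 0, -((2:ℝ)•qI)], ![(2:ℝ)•qK, -((2:ℝ)•qJ), (2:ℝ)•qI, 0]]

theorem qq_rel (i k : Fin 4) : ∑ j, qq j k * qq i j = (if i = k then (12:ℝ) else 0) • 1 - (4:ℝ) • qq i k := by
  fin_cases i <;> fin_cases k <;> simp only [Fin.sum_univ_four] <;> ext <;> simp [qq] <;> norm_num

set_option maxHeartbeats 4000000 in
theorem gS_one (i : Fin 4) (x : E3) : gv i x * (1 - Xs.1 x) = ∑ j, (yv j x : ℍ[ℝ]) * ((1 - Xs.1 x) * qq i j) := by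
  have hJ := (Jr_pos x).ne'
  have ht : (Jr x)⁻¹ * (1 + (x 0 ^2 + x 1 ^2 + x 2 ^2)) = 1 := by rw [← Jr_eq]; exact inv_mul_cancel₀ hJ
  rw [Fin.sum_univ_four]
  fin_cases i
  · change (-(4 * (Jr x)⁻¹) • Xs.1 x) * _ = ((2 * (Jr x)⁻¹ - 1 : ℝ) : ℍ[ℝ]) * ((1 - Xs.1 x) * 0) +
      ((2 * (x 0 * (Jr x)⁻¹) : ℝ) : ℍ[ℝ]) * ((1 - Xs.1 x) * -((2:ℝ)•qI)) +
      ((2 * (x 1 * (Jr x)⁻¹) : ℝ) : ℍ[ℝ]) * ((1 - Xs.1 x) * -((2:ℝ)•qJ)) +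
      ((2 * (x 2 * (Jr x)⁻¹) : ℝ) : ℍ[ℝ]) * ((1 - Xs.1 x) * -((2:ℝ)•qK))
    rw [Xs_ap]
    generalize (Jr x)⁻¹ = t at *
    generalize x 0 = a0 at *
    generalize x 1 = a1 at *
    generalize x 2 = a2 at *
    ext <;> simp only [Quaternion.re_mul, Quaternion.imI_mul, Quaternion.imJ_mul, Quaternion.imK_mul, Quaternion.re_add, Quaternion.imI_add, Quaternion.imJ_add, Quaternion.imK_add, Quaternion.re_sub, Quaternion.imI_sub, Quaternion.imJ_sub, Quaternion.imK_sub, Quaternion.re_neg, Quaternion.imI_neg, Quaternion.imJ_neg, Quaternion.imK_neg, Quaternion.re_smul, Quaternion.imI_smul, Quaternion.imJ_smul, Quaternion.imK_smul, Quaternion.re_coe, Quaternion.imI_coe, Quaternion.imJ_coe, Quaternion.imK_coe, Quaternion.re_one, Quaternion.imI_one, Quaternion.imJ_one, Quaternion.imK_one, Quaternion.re_zero, Quaternion.imI_zero, Quaternion.imJ_zero, Quaternion.imK_zero, qI_re, qI_i, qI_j, qI_k, qJ_re, qJ_i, qJ_j, qJ_k, qK_re, qK_i, qK_j, qK_k,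 smul_eq_mul, zero_mul, mul_zero, mul_one, one_mul, add_zero, zero_add, sub_zero, zero_sub, neg_zero]
    · linear_combination (0) * ht
    · linear_combination (0) * ht
    · linear_combination (0) * ht
    · linear_combination (0) * ht
  · change ((2:ℝ) • qI - (4 * x 0 * (Jr x)⁻¹) • Xs.1 x) * _ = ((2 * (Jr x)⁻¹ - 1 : ℝ) : ℍ[ℝ]) * ((1 - Xs.1 x) * ((2:ℝ)•qI)) +
      ((2 * (x 0 * (Jr x)⁻¹) : ℝ) : ℍ[ℝ]) * ((1 - Xs.1 x) * 0) +
      ((2 * (x 1 * (Jr x)⁻¹) : ℝ) : ℍ[ℝ]) * ((1 - Xs.1 x) * -((2:ℝ)•qK)) +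
      ((2 * (x 2 * (Jr x)⁻¹) : ℝ) : ℍ[ℝ]) * ((1 - Xs.1 x) * ((2:ℝ)•qJ))
    rw [Xs_ap]
    generalize (Jr x)⁻¹ = t at *
    generalize x 0 = a0 at *
    generalize x 1 = a1 at *
    generalize x 2 = a2 at *
    ext <;> simp only [Quaternion.re_mul, Quaternion.imI_mul, Quaternion.imJ_mul, Quaternion.imK_mul, Quaternion.re_add, Quaternion.imI_add, Quaternion.imJ_add, Quaternion.imK_add, Quaternion.re_sub, Quaternion.imI_sub, Quaternion.imJ_sub, Quaternion.imK_sub, Quaternion.re_neg, Quaternion.imI_neg, Quaternion.imJ_neg, Quaternion.imK_neg, Quaternion.re_smul, Quaternion.imI_smul, Quaternion.imJ_smul, Quaternion.imK_smul, Quaternion.re_coe, Quaternion.imI_coe, Quaternion.imJ_coe, Quaternion.imK_coe, Quaternion.re_one, Quaternion.imI_one, Quaternion.imJ_one, Quaternion.imK_one, Quaternion.re_zero, Quaternion.imI_zero, Quaternion.imJ_zero, Quaternion.imK_zero, qI_re, qI_i, qI_j, qI_k, qJ_re, qJ_i, qJ_j, qJ_k, qK_re, qK_i, qK_j, qK_k,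 smul_eq_mul, zero_mul, mul_zero, mul_one, one_mul, add_zero, zero_add, sub_zero, zero_sub, neg_zero]
    · linear_combination (-4*a0) * ht
    · linear_combination (-4) * ht
    · linear_combination (0) * ht
    · linear_combination (0) * ht
  · change ((2:ℝ) • qJ - (4 * x 1 * (Jr x)⁻¹) • Xs.1 x) * _ = ((2 * (Jr x)⁻¹ - 1 : ℝ) : ℍ[ℝ]) * ((1 - Xs.1 x) * ((2:ℝ)•qJ)) +
      ((2 * (x 0 * (Jr x)⁻¹) : ℝ) : ℍ[ℝ]) * ((1 - Xs.1 x) * ((2:ℝ)•qK)) +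
      ((2 * (x 1 * (Jr x)⁻¹) : ℝ) : ℍ[ℝ]) * ((1 - Xs.1 x) * 0) +
      ((2 * (x 2 * (Jr x)⁻¹) : ℝ) : ℍ[ℝ]) * ((1 - Xs.1 x) * -((2:ℝ)•qI))
    rw [Xs_ap]
    generalize (Jr x)⁻¹ = t at *
    generalize x 0 = a0 at *
    generalize x 1 = a1 at *
    generalize x 2 = a2 at *
    ext <;> simp only [Quaternion.re_mul, Quaternion.imI_mul, Quaternion.imJ_mul, Quaternion.imK_mul, Quaternion.re_add, Quaternion.imI_add, Quaternion.imJ_add, Quaternion.imK_add, Quaternion.re_sub, Quaternion.imI_sub, Quaternion.imJ_sub, Quaternion.imK_sub, Quaternion.re_neg, Quaternion.imI_neg, Quaternion.imJ_neg, Quaternion.imK_neg, Quaternion.re_smul, Quaternion.imI_smul, Quaternion.imJ_smul, Quaternion.imK_smul, Quaternion.re_coe, Quaternion.imI_coe, Quaternion.imJ_coe, Quaternion.imK_coe, Quaternion.re_one, Quaternion.imI_one, Quaternion.imJ_one, Quaternion.imK_one, Quaternion.re_zero, Quaternion.imI_zero, Quaternion.imJ_zero, Quaternion.imK_zero, qI_re,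 qI_i, qI_j, qI_k, qJ_re, qJ_i, qJ_j, qJ_k, qK_re, qK_i, qK_j, qK_k, smul_eq_mul, zero_mul, mul_zero, mul_one, one_mul, add_zero, zero_add, sub_zero, zero_sub, neg_zero]
    · linear_combination (-4*a1) * ht
    · linear_combination (0) * ht
    · linear_combination (-4) * ht
    · linear_combination (0) * ht
  · change ((2:ℝ) • qK - (4 * x 2 * (Jr x)⁻¹) • Xs.1 x) * _ = ((2 * (Jr x)⁻¹ - 1 : ℝ) : ℍ[ℝ]) * ((1 - Xs.1 x) * ((2:ℝ)•qK)) +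
      ((2 * (x 0 * (Jr x)⁻¹) : ℝ) : ℍ[ℝ]) * ((1 - Xs.1 x) * -((2:ℝ)•qJ)) +
      ((2 * (x 1 * (Jr x)⁻¹) : ℝ) : ℍ[ℝ]) * ((1 - Xs.1 x) * ((2:ℝ)•qI)) +
      ((2 * (x 2 * (Jr x)⁻¹) : ℝ) : ℍ[ℝ]) * ((1 - Xs.1 x) * 0)
    rw [Xs_ap]
    generalize (Jr x)⁻¹ = t at *
    generalize x 0 = a0 at *
    generalize x 1 = a1 at *
    generalize x 2 = a2 at *
    ext <;> simp only [Quaternion.re_mul, Quaternion.imI_mul, Quaternion.imJ_mul, Quaternion.imK_mul, Quaternion.re_add, Quaternion.imI_add, Quaternion.imJ_add, Quaternion.imK_add, Quaternion.re_sub, Quaternion.imI_sub, Quaternion.imJ_sub, Quaternion.imK_sub, Quaternion.re_neg, Quaternion.imI_neg, Quaternion.imJ_neg, Quaternion.imK_neg, Quaternion.re_smul, Quaternion.imI_smul, Quaternion.imJ_smul, Quaternion.imK_smul, Quaternion.re_coe, Quaternion.imI_coe, Quaternion.imJ_coe, Quaternion.imK_coe, Quaternion.re_one, Quaternion.imI_one,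 Quaternion.imJ_one, Quaternion.imK_one, Quaternion.re_zero, Quaternion.imI_zero, Quaternion.imJ_zero, Quaternion.imK_zero, qI_re, qI_i, qI_j, qI_k, qJ_re, qJ_i, qJ_j, qJ_k, qK_re, qK_i, qK_j, qK_k, smul_eq_mul, zero_mul, mul_zero, mul_one, one_mul, add_zero, zero_add, sub_zero, zero_sub, neg_zero]
    · linear_combination (-4*a2) * ht
    · linear_combination (0) * ht
    · linear_combination (0) * ht
    · linear_combination (-4) * ht

theorem sum_ap {ι : Type*} (s : Finset ι) (f : ι → Sm) (x) : (∑ i ∈ s, f i).1 x = ∑ i ∈ s, (f i).1 x := by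
  have : (∑ i ∈ s, f i).1 = ∑ i ∈ s, (f i).1 := map_sum Sm.val f s
  rw [this, Finset.sum_apply]

theorem gS_psi (i c) : gS i * psi c = ∑ j, yS j * psi (qq i j * c) := by
  refine Sm_ext fun x => ?_
  rw [mul_ap, gS_ap, sum_ap]
  simp only [mul_ap, yS_ap, psi_ap]
  rw [← mul_assoc, ← mul_assoc, ← Quaternion.coe_commutes, mul_assoc _ (gv i x), gS_one, Finset.mul_sum, Finset.sum_mul]
  refine Finset.sum_congr rfl fun j _ => ?_
  simp only [← mul_assoc]
  rw [Quaternion.coe_commutes (yv j x)]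

/-- directions -/
def ee : Fin 4 → ℍ[ℝ] := ![0, qI, qJ, qK]
/-- coefficients -/
def zz (x : E3) : Fin 4 → ℝ := ![1, x 0, x 1, x 2]
/-- coefficients -/
def ww (x : E3) : Fin 4 → ℝ := ![0, x 0, x 1, x 2]

theorem gv_eq (i x) : gv i x = (2:ℝ) • ee i - (4 * zz x i * (Jr x)⁻¹) • Xs.1 x := by
  match i with
  | 0 =>
    change -(4 * (Jr x)⁻¹) • Xs.1 x = (2:ℝ) • 0 - (4 * 1 * (Jr x)⁻¹) • Xs.1 x
    module
  | 1 => rfl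
  | 2 => rfl
  | 3 => rfl

theorem ee_X (i x) : Xs.1 x * ee i + ee i * Xs.1 x = (-2 * ww x i) • 1 := by
  rw [Xs_ap]
  match i with
  | 0 =>
    change _ * 0 + 0 * _ = (-2 * 0 : ℝ) • _
    simp
  | 1 =>
    change _ * qI + qI * _ = (-2 * x 0 : ℝ) • _
    ext <;> simp only [Quaternion.re_mul, Quaternion.imI_mul, Quaternion.imJ_mul, Quaternion.imK_mul, Quaternion.re_add, Quaternion.imI_add, Quaternion.imJ_add, Quaternion.imK_add, Quaternion.re_sub, Quaternion.imI_sub, Quaternion.imJ_sub, Quaternion.imK_sub, Quaternion.re_neg, Quaternion.imI_neg, Quaternion.imJ_neg, Quaternion.imK_neg, Quaternion.re_smul, Quaternion.imI_smul, Quaternion.imJ_smul, Quaternion.imK_smul, Quaternion.re_coe, Quaternion.imI_coe, Quaternion.imJ_coe, Quaternion.imK_coe, Quaternion.re_one, Quaternion.imI_one, Quaternion.imJ_one, Quaternion.imK_one, Quaternion.re_zero, Quaternion.imI_zero, Quaternion.imJ_zero, Quaternion.imK_zero, qI_re, qI_i, qI_j, qI_k, qJ_re, qJ_i, qJ_j,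 qJ_k, qK_re, qK_i, qK_j, qK_k, smul_eq_mul, zero_mul, mul_zero, mul_one, one_mul, add_zero, zero_add, sub_zero, zero_sub, neg_zero] <;> ring
  | 2 =>
    change _ * qJ + qJ * _ = (-2 * x 1 : ℝ) • _
    ext <;> simp only [Quaternion.re_mul, Quaternion.imI_mul, Quaternion.imJ_mul, Quaternion.imK_mul, Quaternion.re_add, Quaternion.imI_add, Quaternion.imJ_add, Quaternion.imK_add, Quaternion.re_sub, Quaternion.imI_sub, Quaternion.imJ_sub, Quaternion.imK_sub, Quaternion.re_neg, Quaternion.imI_neg, Quaternion.imJ_neg, Quaternion.imK_neg, Quaternion.re_smul, Quaternion.imI_smul, Quaternion.imJ_smul, Quaternion.imK_smul, Quaternion.re_coe, Quaternion.imI_coe, Quaternion.imJ_coe, Quaternion.imK_coe, Quaternion.re_one, Quaternion.imI_one, Quaternion.imJ_one, Quaternion.imK_one, Quaternion.re_zero, Quaternion.imI_zero, Quaternion.imJ_zero, Quaternion.imK_zero, qI_re, qI_i, qI_j, qI_k, qJ_re, qJ_i, qJ_j, qJ_k, qK_re, qK_i, qK_j, qK_k, smul_eq_mul, zero_mul, mul_zero,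 mul_one, one_mul, add_zero, zero_add, sub_zero, zero_sub, neg_zero] <;> ring
  | 3 =>
    change _ * qK + qK * _ = (-2 * x 2 : ℝ) • _
    ext <;> simp only [Quaternion.re_mul, Quaternion.imI_mul, Quaternion.imJ_mul, Quaternion.imK_mul, Quaternion.re_add, Quaternion.imI_add, Quaternion.imJ_add, Quaternion.imK_add, Quaternion.re_sub, Quaternion.imI_sub, Quaternion.imJ_sub, Quaternion.imK_sub, Quaternion.re_neg, Quaternion.imI_neg, Quaternion.imJ_neg, Quaternion.imK_neg, Quaternion.re_smul, Quaternion.imI_smul, Quaternion.imJ_smul, Quaternion.imK_smul, Quaternion.re_coe, Quaternion.imI_coe, Quaternion.imJ_coe, Quaternion.imK_coe, Quaternion.re_one, Quaternion.imI_one, Quaternion.imJ_one, Quaternion.imK_one, Quaternion.re_zero, Quaternion.imI_zero, Quaternion.imJ_zero, Quaternion.imK_zero, qI_re, qI_i, qI_j, qI_k, qJ_re, qJ_i, qJ_j, qJ_k, qK_re, qK_i, qK_j, qK_k, smul_eq_mul, zero_mul, mul_zero, mul_one, one_mul, add_zero, zero_add, sub_zero, zero_sub, neg_zero] <;> ring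

/-- Gram -/
def dd (i j : Fin 4) : ℝ := if i = j ∧ i ≠ 0 then 1 else 0

theorem ee_ee (i j) : ee i * ee j + ee j * ee i = (-2 * dd i j) • 1 := by
  fin_cases i <;> fin_cases j <;> ext <;> simp [ee, dd] <;> norm_num

theorem sc_rel (x i j) : -8 * dd i j + 16 * (Jr x)⁻¹ * (zz x i * ww x j + zz x j * ww x i) - 32 * zz x i * zz x j * (Jr x)⁻¹
    + 32 * zz x i * zz x j * (Jr x)⁻¹ ^ 2 = 8 * (yv i x * yv j x) - (if i = j then (8:ℝ) else 0) := by
  fin_cases i <;> fin_cases j <;> simp [zz, ww, yv, dd] <;> ring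

theorem gS_rel (i j : Fin 4) : gS i * gS j + gS j * gS i = (8:ℝ) • (yS i * yS j) - (if i = j then (8:ℝ) else 0) • 1 := by
  refine Sm_ext fun x => ?_
  have hJ := (Jr_pos x).ne'
  simp only [add_ap, mul_ap, sub_ap, smul_ap, gS_ap, one_ap, yS_ap]
  have e : (8:ℝ) • ((yv i x : ℍ[ℝ]) * (yv j x : ℍ[ℝ])) - (if i = j then (8:ℝ) else 0) • (1 : ℍ[ℝ]) =
    (8 * (yv i x * yv j x) - (if i = j then (8:ℝ) else 0)) • (1 : ℍ[ℝ]) := by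
    rw [← Quaternion.coe_mul, sub_smul, mul_smul]
    congr 2
    rw [Algebra.smul_def, mul_one]; rfl
  rw [e, ← sc_rel, gv_eq, gv_eq]
  have h1 := ee_X i x
  have h2 := ee_X j x
  have h3 := ee_ee i j
  have h4 := Xs_sq x
  generalize Xs.1 x = X at *
  generalize ee i = a at *
  generalize ee j = b at *
  have e1 : X * a = (-2 * ww x i) • 1 - a * X := eq_sub_of_add_eq h1
  have e2 : X * b = (-2 * ww x j) • 1 - b * X := eq_sub_of_add_eq h2
  have e3 : b * a = (-2 * dd i j) • 1 - a * b := by rw [← h3]; abel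
  simp only [sub_mul, mul_sub, smul_mul_assoc, mul_smul_comm, e1, e2, e3, h4]
  match_scalars <;> field_simp <;> ring

theorem gS_psi_mem (i c) : gS i * psi c ∈ Wn yS psi 1 := by
  rw [gS_psi]
  refine Submodule.sum_mem _ fun j _ => ?_
  exact Wn_y 0 j ⟨_, rfl⟩

theorem h0_psi (i c) : Gop Aop (yS i) (psi c) = (12:ℝ) • (yS i * psi c) := by
  have hd : ∑ k, yS k * psi ((∑ j, qq j k * qq i j) * c) = (12:ℝ) • (yS i * psi c) - (4:ℝ) • (gS i * psi c) := by
    rw [gS_psi]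
    simp only [qq_rel, sub_mul, map_sub, mul_sub, Finset.sum_sub_distrib, smul_mul_assoc, map_smul, one_mul, mul_smul_comm, Finset.smul_sum]
    simp
  have hd2 : ∑ j, gS j * psi (qq i j * c) = ∑ k, yS k * psi ((∑ j, qq j k * qq i j) * c) := by
    simp only [gS_psi, Finset.sum_mul, map_sum, Finset.mul_sum, mul_assoc]
    rw [Finset.sum_comm]
  rw [Gop_eq Aop_y]
  have h1 : Aop (gS i * psi c) = (3:ℝ) • (gS i * psi c) + ∑ j, gS j * psi (qq i j * c) := by
    rw [gS_psi, map_sum, Finset.smul_sum, ← Finset.sum_add_distrib]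
    refine Finset.sum_congr rfl fun j _ => ?_
    rw [Aop_y, Aop_psi, mul_smul_comm]
  rw [h1, hd2, hd, Aop_psi, mul_smul_comm]
  module
end
end

section
noncomputable section
open scoped Quaternion ContDiff
open MeasureTheory

/-- Decay. -/
def Dk (f : Sm) : Prop := ∃ K, ∀ x, Jr x * ‖f.1 x‖ ≤ K

theorem Dk.add {f g : Sm} (hf : Dk f) (hg : Dk g) : Dk (f + g) := by
  obtain ⟨K, hK⟩ := hf
  obtain ⟨L, hL⟩ := hg
  refine ⟨K + L, fun x => ?_⟩
  have := norm_add_le (f.1 x) (g.1 x)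
  rw [add_ap]
  nlinarith [hK x, hL x, Jr_pos x]

theorem Dk.smul (c : ℝ) {f : Sm} (hf : Dk f) : Dk (c • f) := by
  obtain ⟨K, hK⟩ := hf
  refine ⟨|c| * K, fun x => ?_⟩
  rw [smul_ap, norm_smul, Real.norm_eq_abs]
  nlinarith [hK x, abs_nonneg c]

theorem Dk.bmul {g f : Sm} (C : ℝ) (hg : ∀ x, ‖g.1 x‖ ≤ C) (hf : Dk f) : Dk (g * f) := by
  obtain ⟨K, hK⟩ := hf
  refine ⟨C * K, fun x => ?_⟩
  have h1 := hg x
  have h2 := norm_nonneg (g.1 x)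
  have h3 : 0 ≤ Jr x * ‖f.1 x‖ := mul_nonneg (Jr_pos x).le (norm_nonneg _)
  rw [mul_ap, norm_mul]
  nlinarith [mul_le_mul h1 (hK x) h3 (h2.trans h1)]

theorem Dk.zero : Dk 0 := ⟨0, fun x => by change Jr x * ‖(0 : ℍ[ℝ])‖ ≤ 0; simp⟩

theorem Dk.cs {f : Sm} (hf : HasCompactSupport f.1) : Dk f := by
  have h1 : Continuous (fun x => Jr x • f.1 x) := Jr_smooth.continuous.smul (Sm.cd f).continuous
  have h2 : HasCompactSupport (fun x => Jr x • f.1 x) := hf.mono (fun x hx h0 => hx (by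
    change Jr x • f.1 x = 0
    rw [h0, smul_zero]))
  obtain ⟨C, hC⟩ := h1.bounded_above_of_compact_support h2
  refine ⟨C, fun x => ?_⟩
  have := hC x
  rwa [norm_smul, Real.norm_of_nonneg (Jr_pos x).le] at this

/-- The function space. -/
def Bs : Submodule ℝ Sm where
  carrier := {f | Dk f ∧ ∀ a, Dk (Pd a f)}
  add_mem' := fun {f g} hf hg => ⟨hf.1.add hg.1, fun a => by rw [map_add]; exact (hf.2 a).add (hg.2 a)⟩
  zero_mem' := ⟨Dk.zero, fun a => by rw [map_zero]; exact Dk.zero⟩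
  smul_mem' := fun c f hf => ⟨hf.1.smul c, fun a => by rw [map_smul]; exact (hf.2 a).smul c⟩

theorem Bs_iff {f : Sm} : f ∈ Bs ↔ Dk f ∧ ∀ a, Dk (Pd a f) := Iff.rfl

theorem Pd_cs {f : Sm} (hf : HasCompactSupport f.1) (a) : HasCompactSupport (Pd a f).1 := by
  have : HasCompactSupport (fderiv ℝ f.1) := hf.fderiv ℝ
  exact this.comp_left (g := fun L : E3 →L[ℝ] ℍ[ℝ] => L (bv a)) (by simp)

theorem Bs_cs {f : Sm} (hf : HasCompactSupport f.1) : f ∈ Bs := ⟨Dk.cs hf, fun a => Dk.cs (Pd_cs hf a)⟩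

theorem coord_le (x : E3) (a : Fin 3) : |x a| ≤ ‖x‖ := by
  have := PiLp.norm_apply_le x a
  simpa using this

theorem norm_le_J (x : E3) : 2 * ‖x‖ ≤ Jr x := by unfold Jr; nlinarith [sq_nonneg (‖x‖ - 1)]

theorem yS_bd (i x) : ‖(yS i).1 x‖ ≤ 1 := by
  rw [yS_ap, Quaternion.norm_coe, Real.norm_eq_abs]
  have h1 := Jr_one_le x
  have h2 := norm_le_J x
  have ht : 0 < (Jr x)⁻¹ := inv_pos.2 (Jr_pos x)
  have ht1 : (Jr x)⁻¹ ≤ 1 := inv_le_one_of_one_le₀ h1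
  have key : ∀ a : Fin 3, |2 * (x a * (Jr x)⁻¹)| ≤ 1 := by
    intro a
    rw [abs_mul, abs_mul, abs_of_pos ht, abs_two, ← mul_assoc, ← div_eq_mul_inv, div_le_one (Jr_pos x)]
    linarith [coord_le x a]
  match i with
  | 0 =>
    change |2 * (Jr x)⁻¹ - 1| ≤ 1
    rw [abs_le]; constructor <;> linarith
  | 1 => exact key 0
  | 2 => exact key 1
  | 3 => exact key 2

theorem Ji_bd (x) : ‖Ji.1 x‖ ≤ 1 := by
  rw [Ji_apply, Quaternion.norm_coe, Real.norm_of_nonneg (inv_pos.2 (Jr_pos x)).le]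
  exact inv_le_one_of_one_le₀ (Jr_one_le x)

theorem PdJi_bd (a x) : Jr x * ‖(Pd a Ji).1 x‖ ≤ 1 := by
  rw [Pd_Ji, Quaternion.norm_coe, Real.norm_eq_abs]
  have ht : 0 < (Jr x)⁻¹ := inv_pos.2 (Jr_pos x)
  have h1 := Jr_one_le x
  have h2 := norm_le_J x
  rw [abs_mul, abs_mul, abs_of_pos (pow_pos ht 2)]
  norm_num
  have h3 := coord_le x a
  have : Jr x * (2 * |x a| * (Jr x ^ 2)⁻¹) = 2 * |x a| / Jr x := by
    have := (Jr_pos x).ne'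
    field_simp
  rw [this, div_le_one (Jr_pos x)]
  linarith

theorem PdxJi_bd (a b x) : ‖(Pd a (xc b * Ji)).1 x‖ ≤ 2 := by
  rw [Pd_mul, add_ap, mul_ap, mul_ap]
  refine (norm_add_le _ _).trans ?_
  rw [norm_mul, norm_mul]
  have h1 : ‖(Pd a (xc b)).1 x‖ ≤ 1 := by
    rw [Pd_xc]; split <;> simp
  have h2 : ‖(xc b).1 x‖ ≤ Jr x := by
    rw [xc_ap, Quaternion.norm_coe, Real.norm_eq_abs]
    linarith [coord_le x b, norm_le_J x, norm_nonneg x]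
  have h3 := PdJi_bd a x
  have h4 := Ji_bd x
  have h5 := norm_nonneg ((Pd a Ji).1 x)
  nlinarith [norm_nonneg (Ji.1 x), norm_nonneg ((Pd a (xc b)).1 x)]

theorem PdyS_bd (i a x) : ‖(Pd a (yS i)).1 x‖ ≤ 4 := by
  match i with
  | 0 =>
    rw [yS0, map_sub, map_smul, Pd_one, sub_zero, smul_ap, norm_smul]
    have := PdJi_bd a x
    have h1 := Jr_one_le x
    norm_num
    nlinarith [norm_nonneg ((Pd a Ji).1 x)]
  | 1 =>
    rw [yS1, map_smul, smul_ap, norm_smul]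
    have := PdxJi_bd a 0 x
    norm_num
    linarith
  | 2 =>
    rw [yS2, map_smul, smul_ap, norm_smul]
    have := PdxJi_bd a 1 x
    norm_num
    linarith
  | 3 =>
    rw [yS3, map_smul, smul_ap, norm_smul]
    have := PdxJi_bd a 2 x
    norm_num
    linarith

theorem Bs_y (i) {f : Sm} (hf : f ∈ Bs) : yS i * f ∈ Bs := by
  refine ⟨Dk.bmul 1 (yS_bd i) hf.1, fun a => ?_⟩
  rw [Pd_mul]
  exact (Dk.bmul 4 (PdyS_bd i a) hf.1).add (Dk.bmul 1 (yS_bd i) (hf.2 a))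

theorem norm_one_sub_X (x) : ‖1 - Xs.1 x‖ ^ 2 = Jr x := by
  rw [sq, ← Quaternion.normSq_eq_norm_mul_self, Quaternion.normSq_def', Jr_eq, Xs_ap]
  simp
  ring

theorem norm_one_add_X (x) : ‖1 + Xs.1 x‖ ^ 2 = Jr x := by
  rw [sq, ← Quaternion.normSq_eq_norm_mul_self, Quaternion.normSq_def', Jr_eq, Xs_ap]
  simp
  ring

theorem psi_norm (c x) : Jr x * ‖(psi c).1 x‖ = ‖c‖ := by
  have hJ := Jr_pos x
  rw [psi_ap, norm_mul, norm_mul, Quaternion.norm_coe, Real.norm_of_nonneg (Real.rpow_nonneg hJ.le _)]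
  have : ‖1 - Xs.1 x‖ = Jr x ^ (1/2 : ℝ) := by
    rw [← norm_one_sub_X x, ← Real.sqrt_eq_rpow, Real.sqrt_sq (norm_nonneg _)]
  rw [this, ← Real.rpow_add hJ, ← mul_assoc]
  have : Jr x * Jr x ^ (-3/2 + 1/2 : ℝ) = 1 := by
    rw [show (-3/2 + 1/2 : ℝ) = -1 by norm_num, Real.rpow_neg_one, mul_inv_cancel₀ hJ.ne']
  rw [this, one_mul]

theorem Pd_psi (a c) (x) : Jr x * ‖(Pd a (psi c)).1 x‖ ≤ 4 * ‖c‖ := by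
  have hJ := Jr_pos x
  have hJ1 := Jr_one_le x
  have hp := psi_norm c x
  have e1 : (Pd a (psi c)).1 x = (-3 * x a * (Jr x)⁻¹) • (psi c).1 x - (Jr x ^ (-3/2 : ℝ)) • ((![qI, qJ, qK] a) * c) := by
    rw [psi_ap, psi_apply, Pd_mul, Pd_mul, Pd_cst, map_sub, Pd_one, Pd_Xs]
    simp only [add_ap, mul_ap, Pd_Jp, sub_ap, one_ap, mul_zero, add_zero, zero_sub, neg_ap, cst_ap]
    change (_ + ((Jr x ^ (-3/2 : ℝ) : ℝ) : ℍ[ℝ]) * _) * c = _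
    simp only [Quaternion.coe_mul_eq_smul]
    simp only [smul_mul_assoc, add_mul, neg_mul, smul_smul, smul_neg]
    match_scalars <;> ring
  have h1 : ‖(-3 * x a * (Jr x)⁻¹) • (psi c).1 x‖ ≤ 3 * ‖(psi c).1 x‖ := by
    rw [norm_smul]
    refine mul_le_mul_of_nonneg_right ?_ (norm_nonneg _)
    rw [Real.norm_eq_abs, abs_mul, abs_mul, abs_of_pos (inv_pos.2 hJ), ← div_eq_mul_inv, div_le_iff₀ hJ]
    norm_num
    linarith [coord_le x a, norm_le_J x, norm_nonneg x]
  have h2 : ‖(Jr x ^ (-3/2 : ℝ)) • ((![qI, qJ, qK] a) * c)‖ ≤ (Jr x)⁻¹ * ‖c‖ := by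
    rw [norm_smul, norm_mul, Real.norm_of_nonneg (Real.rpow_nonneg hJ.le _)]
    have : ‖(![qI, qJ, qK] a)‖ = 1 := by
      have e : ∀ z : ℍ[ℝ], Quaternion.normSq z = 1 → ‖z‖ = 1 := by
        intro z hz
        rw [Quaternion.normSq_eq_norm_mul_self] at hz
        nlinarith [norm_nonneg z]
      fin_cases a <;> apply e <;> rw [Quaternion.normSq_def'] <;> simp
    rw [this, one_mul]
    refine mul_le_mul_of_nonneg_right ?_ (norm_nonneg _)
    rw [← Real.rpow_neg_one]
    exact Real.rpow_le_rpow_of_exponent_le hJ1 (by norm_num)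
  rw [e1]
  have h3 := norm_sub_le ((-3 * x a * (Jr x)⁻¹) • (psi c).1 x) ((Jr x ^ (-3/2 : ℝ)) • ((![qI, qJ, qK] a) * c))
  have h4 : Jr x * ((Jr x)⁻¹ * ‖c‖) = ‖c‖ := by rw [← mul_assoc, mul_inv_cancel₀ hJ.ne', one_mul]
  calc _ ≤ Jr x * (3 * ‖(psi c).1 x‖ + (Jr x)⁻¹ * ‖c‖) := mul_le_mul_of_nonneg_left (by linarith) hJ.le
    _ = _ := by rw [mul_add, h4]; linarith

theorem Bs_psi (c) : psi c ∈ Bs := ⟨⟨_, fun x => (psi_norm c x).le⟩, fun a => ⟨_, Pd_psi a c⟩⟩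

theorem Bs_Wn (n) : Wn yS psi n ≤ Bs := by
  induction n with
  | zero => rintro _ ⟨c, rfl⟩; exact Bs_psi c
  | succ n ih =>
    refine sup_le ih (iSup_le fun i => ?_)
    rintro _ ⟨f, hf, rfl⟩
    exact Bs_y i (ih hf)

theorem J2_int : Integrable (fun x : E3 => (Jr x)⁻¹ * (Jr x)⁻¹) := by
  have := integrable_rpow_neg_one_add_norm_sq (E := E3) (μ := volume) (r := 4) (by simp; norm_num)
  refine this.congr (Filter.Eventually.of_forall fun x => ?_)
  change (Jr x) ^ (-4/2 : ℝ) = _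
  rw [show (-4/2 : ℝ) = -1 + -1 by norm_num, Real.rpow_add (Jr_pos x), Real.rpow_neg_one]

theorem Dk_norm {f : Sm} {K} (h : ∀ x, Jr x * ‖f.1 x‖ ≤ K) (x) : ‖f.1 x‖ ≤ K * (Jr x)⁻¹ := by
  rw [← div_eq_mul_inv, le_div_iff₀ (Jr_pos x), mul_comm]; exact h x

theorem Dk_int {f g : Sm} (hf : Dk f) (hg : Dk g) : Integrable (fun x => inner ℝ (f.1 x) (g.1 x)) := by
  obtain ⟨K, hK⟩ := hf
  obtain ⟨L, hL⟩ := hg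
  refine (J2_int.const_mul (K * L)).mono' ?_ (Filter.Eventually.of_forall fun x => ?_)
  · exact ((Sm.cd f).continuous.inner (Sm.cd g).continuous).aestronglyMeasurable
  · have h1 := Dk_norm hK x
    have h2 := Dk_norm hL x
    calc _ ≤ ‖f.1 x‖ * ‖g.1 x‖ := norm_inner_le_norm _ _
      _ ≤ (K * (Jr x)⁻¹) * (L * (Jr x)⁻¹) := mul_le_mul h1 h2 (norm_nonneg _) ((norm_nonneg _).trans h1)
      _ = _ := by ring

theorem Dk_Ji {f : Sm} (hf : Dk f) : Dk (Ji * f) := Dk.bmul 1 Ji_bd hf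

theorem Ji_ap' (f : Sm) (x) : (Ji * f).1 x = (Jr x)⁻¹ • f.1 x := Quaternion.coe_mul_eq_smul _ _

/-- weighted form -/
def bf (f g : Sm) : ℝ := ∫ x, inner ℝ ((Ji * f).1 x) (g.1 x)

theorem bf_def (f g : Sm) : bf f g = ∫ x, (Jr x)⁻¹ * inner ℝ (f.1 x) (g.1 x) := by
  unfold bf
  simp_rw [Ji_ap', real_inner_smul_left]

theorem bf_symm (f g : Sm) : bf f g = bf g f := by
  rw [bf_def, bf_def]; simp_rw [real_inner_comm]

theorem bf_nonneg (f : Sm) : 0 ≤ bf f f := by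
  rw [bf_def]
  exact integral_nonneg fun x => mul_nonneg (inv_pos.2 (Jr_pos x)).le real_inner_self_nonneg

theorem bf_add {f f' g : Sm} (hf : Dk f) (hf' : Dk f') (hg : Dk g) : bf (f + f') g = bf f g + bf f' g := by
  unfold bf
  rw [← integral_add (Dk_int (Dk_Ji hf) hg) (Dk_int (Dk_Ji hf') hg)]
  congr 1; funext x
  rw [mul_add, add_ap, inner_add_left]

theorem bf_smul (c : ℝ) {f g : Sm} : bf (c • f) g = c * bf f g := by
  unfold bf
  rw [← integral_const_mul]
  congr 1; funext x
  rw [mul_smul_comm, smul_ap, real_inner_smul_left]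

/-- bilinear form -/
def bB : Bs →ₗ[ℝ] Bs →ₗ[ℝ] ℝ := LinearMap.mk₂ ℝ (fun f g => bf f.1 g.1)
  (fun f f' g => bf_add f.2.1 f'.2.1 g.2.1) (fun c f g => bf_smul c)
  (fun f g g' => by rw [bf_symm, bf_symm f.1, bf_symm f.1]; exact bf_add g.2.1 g'.2.1 f.2.1)
  (fun c f g => by rw [bf_symm, bf_symm f.1]; exact bf_smul c)

theorem bB_apply (f g : Bs) : bB f g = bf f.1 g.1 := rfl

theorem ibpF {F : Type*} [NormedAddCommGroup F] [InnerProductSpace ℝ F] {f g : E3 → F} {v : E3}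
    (i1 : Integrable (fun x => inner ℝ (fderiv ℝ f x v) (g x)))
    (i2 : Integrable (fun x => inner ℝ (f x) (fderiv ℝ g x v)))
    (i3 : Integrable (fun x => inner ℝ (f x) (g x)))
    (d1 : Differentiable ℝ f) (d2 : Differentiable ℝ g) :
    ∫ x, inner ℝ (f x) (fderiv ℝ g x v) = - ∫ x, inner ℝ (fderiv ℝ f x v) (g x) :=
  integral_bilinear_fderiv_right_eq_neg_left_of_integrable (B := (innerSL ℝ : F →L[ℝ] F →L[ℝ] ℝ)) i1 i2 i3 (fun x _ => d1 x) (fun x _ => d2 x)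

theorem ibp (a) {f g : Sm} (hf : f ∈ Bs) (hg : g ∈ Bs) :
    ∫ x, inner ℝ (f.1 x) ((Pd a g).1 x) = - ∫ x, inner ℝ ((Pd a f).1 x) (g.1 x) := by
  have i1 := Dk_int (hf.2 a) hg.1
  have i2 := Dk_int hf.1 (hg.2 a)
  have i3 := Dk_int hf.1 hg.1
  have d1 := Sm.diff f
  have d2 := Sm.diff g
  simp only [Pd_apply] at *
  exact ibpF i1 i2 i3 d1 d2

theorem inner_skew (e a b : ℍ[ℝ]) (he : star e = -e) : inner ℝ (e * a) b = - inner ℝ a (e * b) := by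
  have h0 : e.re = 0 := by
    have := congrArg (fun q : ℍ[ℝ] => q.re) he
    simp at this; linarith
  rw [Quaternion.inner_def, Quaternion.inner_def]
  simp [h0]; ring

theorem cst_norm_mem (c : ℍ[ℝ]) {f : Sm} (hf : f ∈ Bs) : cst c * f ∈ Bs := by
  refine ⟨Dk.bmul ‖c‖ (fun x => le_rfl) hf.1, fun a => ?_⟩
  rw [Pd_mul, Pd_cst, zero_mul, zero_add]
  exact Dk.bmul ‖c‖ (fun x => le_rfl) (hf.2 a)

theorem ibp_e (e : ℍ[ℝ]) (he : star e = -e) (a) {f g : Sm} (hf : f ∈ Bs) (hg : g ∈ Bs) :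
    ∫ x, inner ℝ ((cst e * Pd a f).1 x) (g.1 x) = ∫ x, inner ℝ (f.1 x) ((cst e * Pd a g).1 x) := by
  have h1 := ibp a hf (cst_norm_mem e hg)
  rw [Pd_mul, Pd_cst, zero_mul, zero_add] at h1
  rw [h1, ← integral_neg]
  congr 1; funext x
  rw [mul_ap, cst_ap, inner_skew _ _ _ he]; rfl

theorem Dk_e (e : ℍ[ℝ]) {f : Sm} (hf : Dk f) : Dk (cst e * f) := Dk.bmul ‖e‖ (fun x => le_rfl) hf

theorem Dop_symm {f g : Sm} (hf : f ∈ Bs) (hg : g ∈ Bs) :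
    ∫ x, inner ℝ ((Dop f).1 x) (g.1 x) = ∫ x, inner ℝ (f.1 x) ((Dop g).1 x) := by
  have hI : star qI = - qI := by ext <;> simp
  have hJ : star qJ = - qJ := by ext <;> simp
  have hK : star qK = - qK := by ext <;> simp
  have l0 := Dk_int (Dk_e qI (hf.2 0)) hg.1
  have l1 := Dk_int (Dk_e qJ (hf.2 1)) hg.1
  have l2 := Dk_int (Dk_e qK (hf.2 2)) hg.1
  have m0 := Dk_int hf.1 (Dk_e qI (hg.2 0))
  have m1 := Dk_int hf.1 (Dk_e qJ (hg.2 1))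
  have m2 := Dk_int hf.1 (Dk_e qK (hg.2 2))
  simp only [Dop_apply, add_ap, inner_add_left, inner_add_right]
  have E : ∀ {u v w : E3 → ℝ}, Integrable u → Integrable v → Integrable w →
      ∫ x, (u x + v x + w x) = (∫ x, u x) + (∫ x, v x) + ∫ x, w x := by
    intro u v w hu hv hw
    rw [← integral_add hu hv]
    exact integral_add (hu.add hv) hw
  rw [E l0 l1 l2, E m0 m1 m2, ibp_e _ hI 0 hf hg, ibp_e _ hJ 1 hf hg, ibp_e _ hK 2 hf hg]

theorem Ji_Aop (f : Sm) : Ji * Aop f = Dop f := by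
  rw [Aop_apply, ← mul_assoc, show Ji * Jf = Jf * Ji from rl_central _ _ _, JJi, one_mul]

theorem Aop_symm {f g : Sm} (hf : f ∈ Bs) (hg : g ∈ Bs) : bf (Aop f) g = bf f (Aop g) := by
  rw [bf_symm f, bf, bf, Ji_Aop, Ji_Aop, Dop_symm hf hg]
  simp_rw [real_inner_comm]
end
end

section
open scoped Quaternion ContDiff
open MeasureTheory Filter Topology
noncomputable section

/-- union of the filtration -/
def VW : Submodule ℝ Sm := ⨆ n, Wn yS psi n

theorem Wn_monotone : Monotone (Wn yS psi) := monotone_nat_of_le_succ fun n _ hf => Wn_mono n hf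

theorem mem_VW {f : Sm} : f ∈ VW ↔ ∃ n, f ∈ Wn yS psi n :=
  Submodule.mem_iSup_of_directed _ Wn_monotone.directed_le

theorem VW_y (i) {f : Sm} (hf : f ∈ VW) : yS i * f ∈ VW := by
  obtain ⟨n, hn⟩ := mem_VW.1 hf
  exact mem_VW.2 ⟨_, Wn_y n i hn⟩

theorem VW_psi (c) : psi c ∈ VW := mem_VW.2 ⟨0, c, rfl⟩

theorem VW_A {f : Sm} (hf : f ∈ VW) : Aop f ∈ VW := by
  obtain ⟨n, hn⟩ := mem_VW.1 hf
  exact mem_VW.2 ⟨_, Wn_A (fun i f => rl_central _ _ f) gS_psi_mem Aop_y Aop_psi n _ hn⟩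

theorem VW_Bs {f : Sm} (hf : f ∈ VW) : f ∈ Bs := by
  obtain ⟨n, hn⟩ := mem_VW.1 hf
  exact Bs_Wn n hn

theorem Jr_tends : Tendsto Jr (cocompact E3) atTop := by
  refine tendsto_atTop_mono norm_le_J ?_
  exact (tendsto_norm_cocompact_atTop).const_mul_atTop (by norm_num)

theorem Jinv_tends : Tendsto (fun x => (Jr x)⁻¹) (cocompact E3) (𝓝 0) := tendsto_inv_atTop_zero.comp Jr_tends

theorem xJ_tends (a : Fin 3) : Tendsto (fun x : E3 => 2 * (x a * (Jr x)⁻¹)) (cocompact E3) (𝓝 0) := by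
  have h2 : Tendsto (fun x : E3 => 2 * ‖x‖⁻¹) (cocompact E3) (𝓝 0) := by
    simpa using (tendsto_inv_atTop_zero.comp (tendsto_norm_cocompact_atTop (E := E3))).const_mul (2:ℝ)
  refine squeeze_zero_norm (fun x => ?_) h2
  have hJ := Jr_pos x
  rw [Real.norm_eq_abs, abs_mul, abs_mul, abs_of_pos (inv_pos.2 hJ), abs_two]
  rcases eq_or_lt_of_le (norm_nonneg x) with h | h
  · have := coord_le x a
    have h0 : |x a| = 0 := le_antisymm (h ▸ this) (abs_nonneg _)
    rw [h0]; simp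
  · have h1 : |x a| * (Jr x)⁻¹ ≤ ‖x‖⁻¹ := by
      rw [← div_eq_mul_inv, div_le_iff₀ hJ]
      calc |x a| ≤ ‖x‖ := coord_le x a
        _ = ‖x‖⁻¹ * ‖x‖^2 := by field_simp
        _ ≤ _ := by gcongr; unfold Jr; linarith
    linarith

/-- limit values at infinity -/
def yl : Fin 4 → ℝ := ![-1, 0, 0, 0]

theorem yv_tends (i : Fin 4) : Tendsto (yv i) (cocompact E3) (𝓝 (yl i)) := by
  match i with
  | 0 =>
    have := (Jinv_tends.const_mul 2).sub_const 1
    have e : (2 * 0 - 1 : ℝ) = yl 0 := by norm_num [yl]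
    rw [← e]; exact this
  | 1 => exact xJ_tends 0
  | 2 => exact xJ_tends 1
  | 3 => exact xJ_tends 2

/-- compactified coordinates -/
def yc (i : Fin 4) : C(OnePoint E3, ℝ) := OnePoint.continuousMapMk ⟨yv i, (yv_smooth i).continuous⟩ (yl i) (by
  rw [coclosedCompact_eq_cocompact]; exact yv_tends i)

theorem yc_coe (i) (x : E3) : yc i (x : OnePoint E3) = yv i x := rfl
theorem yc_inf (i) : yc i OnePoint.infty = yl i := rfl

/-- the algebra -/
def Ay : Subalgebra ℝ C(OnePoint E3, ℝ) := Algebra.adjoin ℝ (Set.range yc)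

theorem yv_inj {x z : E3} (h : ∀ i, yv i x = yv i z) : x = z := by
  have h0 : 2 * (Jr x)⁻¹ - 1 = 2 * (Jr z)⁻¹ - 1 := h 0
  have h1 : 2 * (x 0 * (Jr x)⁻¹) = 2 * (z 0 * (Jr z)⁻¹) := h 1
  have h2 : 2 * (x 1 * (Jr x)⁻¹) = 2 * (z 1 * (Jr z)⁻¹) := h 2
  have h3 : 2 * (x 2 * (Jr x)⁻¹) = 2 * (z 2 * (Jr z)⁻¹) := h 3
  have hJ : (Jr x)⁻¹ = (Jr z)⁻¹ := by linarith
  have hp := (inv_pos.2 (Jr_pos z)).ne'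
  rw [hJ] at h1 h2 h3
  have g : ∀ a b : ℝ, 2 * (a * (Jr z)⁻¹) = 2 * (b * (Jr z)⁻¹) → a = b := fun a b hab =>
    mul_right_cancel₀ hp (mul_left_cancel₀ two_ne_zero hab)
  ext a
  fin_cases a
  · exact g _ _ h1
  · exact g _ _ h2
  · exact g _ _ h3

theorem yc_inj {p q : OnePoint E3} (h : ∀ i, yc i p = yc i q) : p = q := by
  have aux : ∀ x : E3, yc 0 (x : OnePoint E3) ≠ yc 0 OnePoint.infty := by
    intro x hx
    have : 2 * (Jr x)⁻¹ - 1 = -1 := hx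
    have := inv_pos.2 (Jr_pos x)
    linarith
  induction p using OnePoint.rec with
  | infty =>
    induction q using OnePoint.rec with
    | infty => rfl
    | coe z => exact absurd (h 0).symm (aux z)
  | coe x =>
    induction q using OnePoint.rec with
    | infty => exact absurd (h 0) (aux x)
    | coe z => rw [yv_inj (fun i => h i)]

theorem Ay_sep : Ay.SeparatesPoints := by
  intro p q hpq
  by_contra hc
  push Not at hc
  refine hpq (yc_inj fun i => ?_)
  exact hc _ ⟨yc i, Algebra.subset_adjoin ⟨i, rfl⟩, rfl⟩

theorem Ay_VW {Q : C(OnePoint E3, ℝ)} (hQ : Q ∈ Ay) :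
    ∀ f ∈ VW, ∃ g ∈ VW, ∀ x : E3, g.1 x = Q (x : OnePoint E3) • f.1 x := by
  refine Algebra.adjoin_induction (p := fun Q _ => ∀ f ∈ VW, ∃ g ∈ VW, ∀ x : E3, g.1 x = Q (x : OnePoint E3) • f.1 x)
    ?_ ?_ ?_ ?_ hQ
  · rintro _ ⟨i, rfl⟩ f hf
    refine ⟨yS i * f, VW_y i hf, fun x => ?_⟩
    rw [mul_ap, yS_ap, yc_coe, Quaternion.coe_mul_eq_smul]
  · intro r f hf
    exact ⟨r • f, VW.smul_mem r hf, fun x => rfl⟩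
  · intro P Q _ _ hP hQ f hf
    obtain ⟨g, hg, hg'⟩ := hP f hf
    obtain ⟨g1, hg1, hg1'⟩ := hQ f hf
    refine ⟨g + g1, add_mem hg hg1, fun x => ?_⟩
    rw [add_ap, hg', hg1', ← add_smul]; rfl
  · intro P Q _ _ hP hQ f hf
    obtain ⟨g, hg, hg'⟩ := hQ f hf
    obtain ⟨g1, hg1, hg1'⟩ := hP g hg
    refine ⟨g1, hg1, fun x => ?_⟩
    rw [hg1', hg', smul_smul]; rfl

theorem approx_cs {φ : E3 → ℝ} (hφ : Continuous φ) (hc : HasCompactSupport φ) {δ : ℝ} (hδ : 0 < δ) :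
    ∃ Q ∈ Ay, ∀ x : E3, |Q (x : OnePoint E3) - φ x| ≤ δ := by
  have ht : Tendsto φ (coclosedCompact E3) (𝓝 0) := by
    rw [coclosedCompact_eq_cocompact]
    exact hc.is_zero_at_infty
  let F : C(OnePoint E3, ℝ) := OnePoint.continuousMapMk ⟨φ, hφ⟩ 0 ht
  obtain ⟨g, hg⟩ := ContinuousMap.exists_mem_subalgebra_near_continuousMap_of_separatesPoints Ay Ay_sep F δ hδ
  refine ⟨g.1, g.2, fun x => ?_⟩
  exact ((ContinuousMap.norm_coe_le_norm (g.1 - F) (x : OnePoint E3)).trans hg.le)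

theorem psi_inv (u : Sm) (x) :
    (psi (Jr x ^ (1/2 : ℝ) • ((1 + Xs.1 x) * u.1 x))).1 x = u.1 x := by
  have h : (1 - Xs.1 x) * ((1 + Xs.1 x) * u.1 x) = Jr x • u.1 x := by
    have := Xs_sq x
    calc _ = u.1 x - (Xs.1 x * Xs.1 x) * u.1 x := by noncomm_ring
      _ = _ := by rw [this, smul_mul_assoc, one_mul]; module
  rw [psi_ap, mul_assoc, mul_smul_comm, h, Quaternion.coe_mul_eq_smul, smul_smul, smul_smul]
  have : Jr x ^ (-3/2:ℝ) * Jr x ^ (1/2:ℝ) * Jr x = 1 := by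
    nth_rw 3 [← Real.rpow_one (Jr x)]
    rw [← Real.rpow_add (Jr_pos x), ← Real.rpow_add (Jr_pos x)]
    norm_num
  rw [this, one_smul]

theorem q_basis (c : ℍ[ℝ]) : c = c.re • 1 + c.imI • qI + c.imJ • qJ + c.imK • qK := by
  ext <;> simp

theorem approx_one (e : ℍ[ℝ]) (he : ‖e‖ = 1) {φ : E3 → ℝ} (hφ : Continuous φ) (hc : HasCompactSupport φ) {δ : ℝ} (hδ : 0 < δ) :
    ∃ g ∈ VW, ∀ x, Jr x * ‖φ x • (psi e).1 x - g.1 x‖ ≤ δ := by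
  obtain ⟨Q, hQ, hQ'⟩ := approx_cs hφ hc hδ
  obtain ⟨g, hg, hg'⟩ := Ay_VW hQ _ (VW_psi e)
  refine ⟨g, hg, fun x => ?_⟩
  rw [hg', ← sub_smul, norm_smul, mul_left_comm, psi_norm, he, mul_one, norm_sub_rev]
  exact hQ' x

theorem n1 : ‖(1:ℍ[ℝ])‖ = 1 := norm_one
theorem nI : ‖qI‖ = 1 := by
  have := Quaternion.normSq_eq_norm_mul_self qI
  rw [Quaternion.normSq_def'] at this; simp at this; nlinarith [norm_nonneg qI]
theorem nJ : ‖qJ‖ = 1 := by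
  have := Quaternion.normSq_eq_norm_mul_self qJ
  rw [Quaternion.normSq_def'] at this; simp at this; nlinarith [norm_nonneg qJ]
theorem nK : ‖qK‖ = 1 := by
  have := Quaternion.normSq_eq_norm_mul_self qK
  rw [Quaternion.normSq_def'] at this; simp at this; nlinarith [norm_nonneg qK]

theorem exF {u : Sm} (hu : HasCompactSupport u.1) :
    ∃ F : E3 → ℍ[ℝ], Continuous F ∧ HasCompactSupport F ∧ ∀ x, (psi (F x)).1 x = u.1 x := by
  refine ⟨fun x => Jr x ^ (1/2 : ℝ) • ((1 + Xs.1 x) * u.1 x), ?_, ?_, psi_inv u⟩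
  · have h1 := (Jp_smooth (1/2)).continuous
    have h2 := (Sm.cd Xs).continuous
    have h3 := (Sm.cd u).continuous
    exact h1.smul ((continuous_const.add h2).mul h3)
  · have h1 : HasCompactSupport (fun x => (1 + Xs.1 x) * u.1 x) := hu.mul_left
    refine h1.mono' (fun x hx => subset_closure fun h0 => hx ?_)
    have h0' : (1 + Xs.1 x) * u.1 x = 0 := h0
    simp only [h0', smul_zero]

theorem psi_dec (c : ℍ[ℝ]) (x) : (psi c).1 x = c.re • (psi 1).1 x + c.imI • (psi qI).1 x + c.imJ • (psi qJ).1 x + c.imK • (psi qK).1 x := by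
  conv_lhs => rw [q_basis c]
  rw [map_add, map_add, map_add, map_smul, map_smul, map_smul, map_smul, add_ap, add_ap, add_ap, smul_ap, smul_ap, smul_ap, smul_ap]

theorem four_le {V : Type*} [NormedAddCommGroup V] (u a b c d a' b' c' d' : V) (J δ : ℝ) (hJ : 0 < J)
    (hu : u = a + b + c + d) (ha : J * ‖a - a'‖ ≤ δ) (hb : J * ‖b - b'‖ ≤ δ) (hc : J * ‖c - c'‖ ≤ δ)
    (hd : J * ‖d - d'‖ ≤ δ) : J * ‖u - (a' + b' + c' + d')‖ ≤ 4 * δ := by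
  have e : u - (a' + b' + c' + d') = (a - a') + (b - b') + (c - c') + (d - d') := by rw [hu]; abel
  rw [e]
  have := mul_le_mul_of_nonneg_left (norm_add₄_le (a := a - a') (b := b - b') (c := c - c') (d := d - d')) hJ.le
  linarith

theorem approx_u {u : Sm} (hu : HasCompactSupport u.1) {δ : ℝ} (hδ : 0 < δ) :
    ∃ g ∈ VW, ∀ x, Jr x * ‖(u - g).1 x‖ ≤ 4 * δ := by
  obtain ⟨F, hF, hFc, hFu⟩ := exF hu
  obtain ⟨g0, hg0, h0⟩ := approx_one 1 n1 (φ := fun x => (F x).re) (Quaternion.continuous_re.comp hF) (hFc.comp_left (g := fun q : ℍ[ℝ] => q.re) rfl) hδ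
  obtain ⟨g1, hg1, h1⟩ := approx_one qI nI (φ := fun x => (F x).imI) (Quaternion.continuous_imI.comp hF) (hFc.comp_left (g := fun q : ℍ[ℝ] => q.imI) rfl) hδ
  obtain ⟨g2, hg2, h2⟩ := approx_one qJ nJ (φ := fun x => (F x).imJ) (Quaternion.continuous_imJ.comp hF) (hFc.comp_left (g := fun q : ℍ[ℝ] => q.imJ) rfl) hδ
  obtain ⟨g3, hg3, h3⟩ := approx_one qK nK (φ := fun x => (F x).imK) (Quaternion.continuous_imK.comp hF) (hFc.comp_left (g := fun q : ℍ[ℝ] => q.imK) rfl) hδ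
  refine ⟨g0 + g1 + g2 + g3, add_mem (add_mem (add_mem hg0 hg1) hg2) hg3, fun x => ?_⟩
  rw [sub_ap, add_ap, add_ap, add_ap]
  exact four_le _ _ _ _ _ _ _ _ _ _ _ (Jr_pos x) ((hFu x).symm.trans (psi_dec (F x) x)) (h0 x) (h1 x) (h2 x) (h3 x)

theorem bf_small {f : Sm} {K : ℝ} (hf : ∀ x, Jr x * ‖f.1 x‖ ≤ K) :
    bf f f ≤ K^2 * ∫ x : E3, (Jr x)⁻¹ * (Jr x)⁻¹ := by
  rw [bf_def, ← integral_const_mul]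
  refine integral_mono_of_nonneg (ae_of_all _ fun x => ?_) (J2_int.const_mul _) (ae_of_all _ fun x => ?_)
  · have := Jr_pos x
    have := real_inner_self_nonneg (x := f.1 x)
    change 0 ≤ (Jr x)⁻¹ * _
    positivity
  · have hJ := inv_pos.2 (Jr_pos x)
    have h1 := Dk_norm hf x
    have h2 : (Jr x)⁻¹ ≤ 1 := inv_le_one_of_one_le₀ (Jr_one_le x)
    change (Jr x)⁻¹ * inner ℝ (f.1 x) (f.1 x) ≤ K^2 * ((Jr x)⁻¹ * (Jr x)⁻¹)
    rw [real_inner_self_eq_norm_mul_norm]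
    calc (Jr x)⁻¹ * (‖f.1 x‖ * ‖f.1 x‖) ≤ 1 * ((K * (Jr x)⁻¹) * (K * (Jr x)⁻¹)) := by
          have := (norm_nonneg _).trans h1
          gcongr
      _ = _ := by ring

theorem dense_u {u : Sm} (hu : HasCompactSupport u.1) {ε : ℝ} (hε : 0 < ε) :
    ∃ g ∈ VW, bf (u - g) (u - g) ≤ ε := by
  set I := ∫ x : E3, (Jr x)⁻¹ * (Jr x)⁻¹
  have hI : 0 ≤ I := integral_nonneg fun x => mul_self_nonneg _
  obtain ⟨g, hg, h⟩ := approx_u hu (δ := √(ε / (16 * (I + 1)))) (by positivity)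
  refine ⟨g, hg, (bf_small h).trans ?_⟩
  rw [mul_pow, Real.sq_sqrt (by positivity)]
  have : (4:ℝ)^2 * (ε / (16 * (I+1))) * I = ε * (I / (I+1)) := by field_simp; ring
  rw [this]
  have : I / (I+1) ≤ 1 := by rw [div_le_one (by positivity)]; linarith
  nlinarith
end
end

section
open scoped Quaternion ContDiff
open MeasureTheory
noncomputable section

theorem cs_mul (g : Sm) {f : Sm} (hf : HasCompactSupport f.1) : HasCompactSupport (g * f).1 := by
  refine hf.mono' (fun x hx => subset_closure fun h0 => hx ?_)
  have h0' : f.1 x = 0 := h0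
  rw [mul_ap, h0', mul_zero]

theorem cs_add {f g : Sm} (hf : HasCompactSupport f.1) (hg : HasCompactSupport g.1) : HasCompactSupport (f + g).1 :=
  hf.add hg

theorem cs_smul (c : ℝ) {f : Sm} (hf : HasCompactSupport f.1) : HasCompactSupport (c • f).1 := by
  refine hf.mono' (fun x hx => subset_closure fun h0 => hx ?_)
  have h0' : f.1 x = 0 := h0
  rw [smul_ap, h0', smul_zero]

theorem cs_Dop {f : Sm} (hf : HasCompactSupport f.1) : HasCompactSupport (Dop f).1 :=
  cs_add (cs_add (cs_mul _ (Pd_cs hf 0)) (cs_mul _ (Pd_cs hf 1))) (cs_mul _ (Pd_cs hf 2))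

theorem cs_Aop {f : Sm} (hf : HasCompactSupport f.1) : HasCompactSupport (Aop f).1 := cs_mul _ (cs_Dop hf)

/-- as endomorphism -/
abbrev AE : Module.End ℝ Sm := Aop

theorem fpol_succ_ap (r : ℕ) (f : Sm) : fpol AE (r+1) f = fpol AE r (Aop (Aop f)) + (-(4 * ((r:ℝ)+1)*((r:ℝ)+1))) • fpol AE r f := by
  have e4 : (4 : Module.End ℝ Sm) = (4:ℝ) • 1 := by
    rw [← Algebra.algebraMap_eq_smul_one]; exact (map_ofNat (algebraMap ℝ (Module.End ℝ Sm)) _).symm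
  have er : ((r : Module.End ℝ Sm)) = (r:ℝ) • 1 := by
    rw [← Algebra.algebraMap_eq_smul_one]; exact (map_natCast (algebraMap ℝ (Module.End ℝ Sm)) _).symm
  have e : (4 * ((r:Module.End ℝ Sm)+1)*((r:Module.End ℝ Sm)+1) * fpol AE r) = (4 * ((r:ℝ)+1)*((r:ℝ)+1)) • fpol AE r := by
    have : (r:Module.End ℝ Sm)+1 = ((r:ℝ)+1) • 1 := by rw [er, add_smul, one_smul]
    rw [this, e4]
    simp only [smul_mul_assoc, mul_smul_comm, one_mul, smul_smul, mul_one]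
    congr 1; ring
  rw [fpol, e, neg_smul, ← sub_eq_add_neg]
  rfl

theorem cs_fpol (r : ℕ) {f : Sm} (hf : HasCompactSupport f.1) : HasCompactSupport (fpol AE r f).1 := by
  induction r generalizing f with
  | zero => exact cs_Aop hf
  | succ r ih =>
    rw [fpol_succ_ap]
    exact cs_add (ih (cs_Aop (cs_Aop hf))) (cs_smul _ (ih hf))

theorem bf_smul_right (c : ℝ) {f g : Sm} : bf f (c • g) = c * bf f g := by
  rw [bf_symm, bf_smul, bf_symm]

theorem bf_fpol (r : ℕ) {f g : Sm} (hf : HasCompactSupport f.1) (hg : g ∈ Bs) (m : ℝ) (hm : Aop g = m • g) :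
    bf (fpol AE r f) g = muv m r * bf f g := by
  induction r generalizing f with
  | zero =>
    change bf (Aop f) g = m * _
    rw [Aop_symm (Bs_cs hf) hg, hm, bf_smul_right]
  | succ r ih =>
    have h2 := cs_Aop (cs_Aop hf)
    rw [fpol_succ_ap, bf_add (Bs_cs (cs_fpol r h2)).1 (Bs_cs (cs_smul _ (cs_fpol r hf))).1 hg.1, bf_smul, ih hf, ih h2,
      Aop_symm (Bs_cs (cs_Aop hf)) hg, hm, bf_smul_right, Aop_symm (Bs_cs hf) hg, hm, bf_smul_right, muv]
    ring

theorem bf_orth {f g : Sm} (hf : f ∈ Bs) (hg : g ∈ Bs) {m n : ℤ} (hmn : m ≠ n) (h1 : Aop f = (m:ℝ) • f) (h2 : Aop g = (n:ℝ) • g) :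
    bf f g = 0 := by
  have := Aop_symm hf hg
  rw [h1, h2, bf_smul, bf_smul_right] at this
  have h3 : ((m:ℝ) - n) ≠ 0 := sub_ne_zero.2 (by exact_mod_cast hmn)
  have h4 : ((m:ℝ) - n) * bf f g = 0 := by linarith
  exact (mul_eq_zero.1 h4).resolve_left h3

theorem main_ineq (r : ℕ) {u : Sm} (hu : HasCompactSupport u.1) :
    |muv 3 r| * √(bf u u) ≤ √(bf (fpol AE r u) (fpol AE r u)) := by
  have ht := cs_fpol r hu
  refine abstract_concl (V := Bs) bB (fun f g => bf_symm f.1 g.1) (fun f => bf_nonneg f.1) ⟨u, Bs_cs hu⟩ ⟨_, Bs_cs ht⟩ _ (muv_three_pos r) ?_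
  intro ε hε
  obtain ⟨f, hf, hfe⟩ := dense_u hu hε
  obtain ⟨l, hl⟩ := mem_VW.1 hf
  obtain ⟨M, hM, hD⟩ := Wn_dec (fun i f => rl_central _ _ f) Aop_y gS_psi_mem Aop_psi gS_rel h0_psi VW (fun f hf => VW_A hf)
    (fun n f hf => mem_VW.2 ⟨n, hf⟩) l
  obtain ⟨g, hg, hfg⟩ := hD f hl
  classical
  let G : ℤ → Bs := fun m => if h : m ∈ M then ⟨g m, VW_Bs (hg m h).1⟩ else 0
  have hG : ∀ m ∈ M, (G m).1 = g m := fun m hm => by simp only [G, dif_pos hm]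
  refine ⟨M, G, fun m => muv m r, fun m hm => muv_ge r m (hM m hm).1 (hM m hm).2.1, ?_, ?_, ?_⟩
  · intro m hm n hn hmn
    rw [bB_apply, hG m hm, hG n hn]
    exact bf_orth (VW_Bs (hg m hm).1) (VW_Bs (hg n hn).1) hmn (hg m hm).2 (hg n hn).2
  · intro m hm
    rw [bB_apply, bB_apply, hG m hm]
    exact bf_fpol r hu (VW_Bs (hg m hm).1) _ (hg m hm).2
  · rw [bB_apply]
    have e : ((⟨u, Bs_cs hu⟩ - ∑ m ∈ M, G m : Bs) : Sm) = u - f := by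
      rw [Submodule.coe_sub, Submodule.coe_sum, hfg, Finset.sum_congr rfl hG]
    rw [e]; exact hfe

theorem mulLeft_pow_ap (g f : Sm) (r : ℕ) : ((LinearMap.mulLeft ℝ g : Module.End ℝ Sm)^r) f = g^r * f := by
  induction r generalizing f with
  | zero => simp
  | succ r ih => rw [pow_succ, Module.End.mul_apply, ih, LinearMap.mulLeft_apply, ← mul_assoc, ← pow_succ]

theorem Dpow (k : ℕ) (f : Sm) : (((Dop : Module.End ℝ Sm)^k) f).1 = diracQ^[k] f.1 := by
  induction k with
  | zero => rfl
  | succ k ih => rw [pow_succ', Module.End.mul_apply, Dop_coe, ih, Function.iterate_succ_apply']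

theorem Jf_pow_Ji (r : ℕ) : Jf^r * Ji^r = 1 := by
  have hc : Commute Jf Ji := rl_central _ _ _
  rw [← hc.mul_pow, JJi, one_pow]

theorem t_eq (r : ℕ) (H : Sm) : fpol AE r (Ji^r * H) = Jf^(r+1) * ((Dop : Module.End ℝ Sm)^(2*r+1)) H := by
  have := congrArg (fun L : Module.End ℝ Sm => L (Ji^r * H))
    (T_eq (R := Module.End ℝ Sm) Dop (LinearMap.mulLeft ℝ Xs) (LinearMap.mulLeft ℝ Jf) r2 r6
      (rel_R (R := Module.End ℝ Sm) Dop (LinearMap.mulLeft ℝ Xs) (LinearMap.mulLeft ℝ Jf) Uop r1 r2 r3 r4 r5 r6) r)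
  simp only [Module.End.mul_apply, mulLeft_pow_ap] at this
  rw [← mul_assoc, Jf_pow_Ji, one_mul] at this
  exact this.symm

theorem Jf_pow_ap (n : ℕ) (f : Sm) (x) : (Jf^n * f).1 x = (Jr x ^ n) • f.1 x := by
  induction n generalizing f with
  | zero => simp
  | succ n ih => rw [pow_succ, mul_assoc, ih, mul_ap, Jf_apply, Quaternion.coe_mul_eq_smul, smul_smul, pow_succ]

theorem Ji_pow_ap (n : ℕ) (f : Sm) (x) : (Ji^n * f).1 x = ((Jr x)⁻¹ ^ n) • f.1 x := by
  induction n generalizing f with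
  | zero => simp
  | succ n ih => rw [pow_succ, mul_assoc, ih, Ji_ap', smul_smul, pow_succ]

theorem inner_sm (c : ℝ) (q : ℍ[ℝ]) : inner ℝ (c • q) (c • q) = c^2 * ‖q‖^2 := by
  rw [real_inner_self_eq_norm_sq, norm_smul, mul_pow, Real.norm_eq_abs, sq_abs]

theorem final_ineq (k : ℕ) (hk : Odd k) (h : E3 → ℍ[ℝ])
    (hsmooth : ContDiff ℝ (⊤ : ℕ∞) h) (hsupp : HasCompactSupport h) :
    ((∏ j ∈ Finset.range ((k - 1) / 2 + 1), ((3 : ℝ) + 2 * j)) *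
          ∏ j ∈ Finset.Icc 1 ((k - 1) / 2), |2 * (j : ℝ) - 3|) *
        Real.sqrt (∫ x, ‖h x‖ ^ 2 / (1 + ‖x‖ ^ 2) ^ k) ≤
    Real.sqrt (∫ x, ‖diracQ^[k] h x‖ ^ 2 * (1 + ‖x‖ ^ 2) ^ k) := by
  obtain ⟨r, rfl⟩ := hk
  have er : (2 * r + 1 - 1) / 2 = r := by omega
  rw [er, ← muv_three]
  let H : Sm := ⟨h, hsmooth⟩
  have key := main_ineq r (u := Ji^r * H) (cs_mul _ hsupp)
  rw [t_eq, bf_def, bf_def] at key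
  have e1 : ∀ x, (Jr x)⁻¹ * inner ℝ ((Ji^r * H).1 x) ((Ji^r * H).1 x) = ‖h x‖ ^ 2 / (1 + ‖x‖ ^ 2) ^ (2*r+1) := by
    intro x
    rw [Ji_pow_ap, inner_sm]
    have hJ := (Jr_pos x).ne'
    change (Jr x)⁻¹ * (((Jr x)⁻¹ ^ r)^2 * ‖h x‖^2) = ‖h x‖^2 / (Jr x)^(2*r+1)
    rw [div_eq_mul_inv, ← inv_pow]
    ring
  have e2 : ∀ x, (Jr x)⁻¹ * inner ℝ ((Jf^(r+1) * ((Dop : Module.End ℝ Sm)^(2*r+1)) H).1 x)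
      ((Jf^(r+1) * ((Dop : Module.End ℝ Sm)^(2*r+1)) H).1 x) = ‖diracQ^[2*r+1] h x‖ ^ 2 * (1 + ‖x‖ ^ 2) ^ (2*r+1) := by
    intro x
    rw [Jf_pow_ap, inner_sm, Dpow]
    have hJ := inv_mul_cancel₀ (Jr_pos x).ne'
    change (Jr x)⁻¹ * (((Jr x) ^ (r+1))^2 * ‖diracQ^[2*r+1] h x‖^2) = ‖diracQ^[2*r+1] h x‖^2 * (Jr x)^(2*r+1)
    linear_combination (Jr x ^ (2*r+1) * ‖diracQ^[2*r+1] h x‖^2) * hJ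
  simp only [e1, e2] at key
  exact key

end
end

/-- The sharp weighted inequality for odd powers of the Dirac operator on `ℝ³`:
for `k` a positive odd integer and `h : ℝ³ → ℍ` smooth with compact support,
`(∫ ‖D^k h‖² (1+‖x‖²)^k dx)^{1/2} ≥ c (∫ ‖h‖²/(1+‖x‖²)^k dx)^{1/2}` with
`c = (∏_{j=0}^{(k-1)/2} (3+2j)) · (∏_{j=1}^{(k-1)/2} |2j-3|)`, the case `n = 3` of
`c = |n(n+2)(2-n)⋯(n+k-1)(k-1-n)|`. -/
theorem weighted_dirac_power_inequality_R3 (k : ℕ) (hk : Odd k)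
    (h : EuclideanSpace ℝ (Fin 3) → Quaternion ℝ)
    (hsmooth : ContDiff ℝ (⊤ : ℕ∞) h) (hsupp : HasCompactSupport h) :
    Real.sqrt (∫ x, ‖diracQ^[k] h x‖ ^ 2 * (1 + ‖x‖ ^ 2) ^ k) ≥
      ((∏ j ∈ Finset.range ((k - 1) / 2 + 1), ((3 : ℝ) + 2 * j)) *
          ∏ j ∈ Finset.Icc 1 ((k - 1) / 2), |2 * (j : ℝ) - 3|) *
        Real.sqrt (∫ x, ‖h x‖ ^ 2 / (1 + ‖x‖ ^ 2) ^ k) := by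
  exact final_ineq k hk h hsmooth hsupp

end
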